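/- arXiv:1708.05815 — 11 statements merged into one kernel-verified Lean document; each statement's English description precedes it below -/
import Mathlib

section
/- Let P ⊆ ℝ × ℝ be orthoconvex in the sense that for every y ∈ ℝ the horizontal slice {x : (x, y) ∈ P} is order-connected and for every x ∈ ℝ the vertical slice {y : (x, y) ∈ P} is order-connected. Suppose there are reals x₀, y₀ such that for every p ∈ P both (p.1, y₀) ∈ P and (x₀, p.2) ∈ P (i.e., P contains a horizontal segment at height y₀ spanning all x-coordinates occurring in P and a vertical segment at abscissa x₀ spanning all y-coordinates occurring in P). Then the point φ = (x₀, y₀) lies in P and φ lies in the kernel of P: for every p ∈ P, the rectangle Set.uIcc x₀ p.1 ×ˢ Set.uIcc y₀ p.2 is contained in P, so every point of P is r-visible from φ. -/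
/-- In an orthoconvex region `P` (all horizontal and vertical slices are
order-connected) that contains a horizontal segment at height `y₀` spanning all occurring
x-coordinates and a vertical segment at abscissa `x₀` spanning all occurring y-coordinates,
the point `φ = (x₀, y₀)` lies in `P` and belongs to its kernel: every point of `P` is
r-visible from `φ`. -/
theorem stmt_0 (P : Set (ℝ × ℝ))
    (hH : ∀ y : ℝ, Set.OrdConnected {x : ℝ | (x, y) ∈ P})
    (hV : ∀ x : ℝ, Set.OrdConnected {y : ℝ | (x, y) ∈ P})
    (hne : P.Nonempty) (x₀ y₀ : ℝ)
    (hx : ∀ p ∈ P, ((p.1, y₀) : ℝ × ℝ) ∈ P)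
    (hy : ∀ p ∈ P, ((x₀, p.2) : ℝ × ℝ) ∈ P) :
    ((x₀, y₀) : ℝ × ℝ) ∈ P ∧
      ∀ p ∈ P, Set.uIcc x₀ p.1 ×ˢ Set.uIcc y₀ p.2 ⊆ P := by
  refine ⟨?_, ?_⟩
  · obtain ⟨p, hp⟩ := hne
    exact hy _ (hx p hp)
  · rintro p hp ⟨u, v⟩ ⟨hu, hv⟩
    have hup : (u, p.2) ∈ P := (hH p.2).uIcc_subset (hy p hp) hp hu
    exact (hV u).uIcc_subset (hx _ hup) hup hv
end

section
/- Let P ⊆ ℝ × ℝ be orthoconvex in the sense that for every y ∈ ℝ the horizontal slice {x : (x, y) ∈ P} is order-connected and for every x ∈ ℝ the vertical slice {y : (x, y) ∈ P} is order-connected, and suppose there are reals x₀, y₀ such that for every p ∈ P both (p.1, y₀) ∈ P and (x₀, p.2) ∈ P. Let φ = (x₀, y₀) and let Q be any of the four closed quadrants with corner φ (for instance Q = {q : q.1 ≥ x₀ ∧ q.2 ≥ y₀}). Then the piece P ∩ Q is r-star-shaped with core φ: for every p ∈ P ∩ Q, the rectangle Set.uIcc x₀ p.1 ×ˢ Set.uIcc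 y₀ p.2 is contained in P ∩ Q. In particular the horizontal segment at height y₀ and the vertical segment at abscissa x₀ decompose P into four sub-regions each entirely r-visible from φ. -/
/-- Under the hypotheses of Statement 0, for any of the four closed quadrants
`Q` with corner `φ = (x₀, y₀)`, the piece `P ∩ Q` is r-star-shaped with core `φ`. -/
theorem stmt_1 (P : Set (ℝ × ℝ))
    (hH : ∀ y : ℝ, Set.OrdConnected {x : ℝ | (x, y) ∈ P})
    (hV : ∀ x : ℝ, Set.OrdConnected {y : ℝ | (x, y) ∈ P})
    (hne : P.Nonempty) (x₀ y₀ : ℝ)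
    (hx : ∀ p ∈ P, ((p.1, y₀) : ℝ × ℝ) ∈ P)
    (hy : ∀ p ∈ P, ((x₀, p.2) : ℝ × ℝ) ∈ P) :
    ∀ (sx sy : Bool) (Q : Set (ℝ × ℝ)),
      Q = {q : ℝ × ℝ | (if sx then x₀ ≤ q.1 else q.1 ≤ x₀) ∧
                       (if sy then y₀ ≤ q.2 else q.2 ≤ y₀)} →
      ((x₀, y₀) : ℝ × ℝ) ∈ P ∩ Q ∧
        ∀ p ∈ P ∩ Q, Set.uIcc x₀ p.1 ×ˢ Set.uIcc y₀ p.2 ⊆ P ∩ Q := by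
  rintro sx sy Q rfl
  refine ⟨⟨?_, ?_⟩, ?_⟩
  · obtain ⟨p, hp⟩ := hne
    exact hy _ (hx p hp)
  · cases sx <;> cases sy <;> simp
  · rintro ⟨a, b⟩ ⟨hp, hq⟩ ⟨u, v⟩ ⟨hu, hv⟩
    refine ⟨?_, ?_⟩
    · have hub : (u, b) ∈ P := (hH b).uIcc_subset (hy _ hp) hp hu
      exact (hV u).uIcc_subset (hx _ hub) hub hv
    · simp only [Set.mem_uIcc] at hu hv
      cases sx <;> cases sy <;> simp at hq ⊢ <;> grind
end

section
/- Let P ⊆ ℝ × ℝ, let a < b and y be reals, and suppose the horizontal segment e = [a, b] × {y} is contained in P and is horizontally maximal on both sides: for every ε > 0, (a − ε, y) ∉ P and (b + ε, y) ∉ P. If a point g ∈ P is r-visible in P from some point of e, then a ≤ g.1 ≤ b. (A tooth edge can only be guarded by a guard lying in its orthogonal shadow strip.) -/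
/-- A horizontally maximal (tooth) edge `e = [a,b] × {y} ⊆ P` can only be
r-seen by guards whose first coordinate lies in `[a, b]`. -/
theorem stmt_2 (P : Set (ℝ × ℝ)) (a b y : ℝ) (hab : a < b)
    (he : Set.Icc a b ×ˢ ({y} : Set ℝ) ⊆ P)
    (hmaxL : ∀ ε > (0 : ℝ), ((a - ε, y) : ℝ × ℝ) ∉ P)
    (hmaxR : ∀ ε > (0 : ℝ), ((b + ε, y) : ℝ × ℝ) ∉ P)
    (g : ℝ × ℝ) (hg : g ∈ P)
    (hvis : ∃ q ∈ Set.Icc a b ×ˢ ({y} : Set ℝ),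
      Set.uIcc g.1 q.1 ×ˢ Set.uIcc g.2 q.2 ⊆ P) :
    a ≤ g.1 ∧ g.1 ≤ b := by
  obtain ⟨q, ⟨-, hq⟩, hsub⟩ := hvis
  obtain rfl : q.2 = y := hq
  have hcorner : (g.1, q.2) ∈ P := hsub ⟨Set.left_mem_uIcc, Set.right_mem_uIcc⟩
  constructor
  · by_contra! h
    exact hmaxL (a - g.1) (sub_pos.2 h) (by simpa using hcorner)
  · by_contra! h
    exact hmaxR (g.1 - b) (sub_pos.2 h) (by simpa using hcorner)
end

section
/- Let P be a histogram region with breakpoints x_0 < ⋯ < x_N and heights c_1, …, c_N, and suppose the heights are unimodal: there is an index m with c_i < c_{i+1} for all i < m and c_i > c_{i+1} for all i ≥ m (equivalently, P is a pyramid: column m is the unique tooth). Then every point of the base segment of the apex column, [x_{m−1}, x_m] × {0}, r-sees every point of P; in particular the pyramid P is r-star-shaped (its kernel is nonempty). -/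
theorem le_of_forall_le_succ {α : Type*} [Preorder α] {f : ℕ → α} {a b : ℕ} (hab : a ≤ b)
    (h : ∀ i, a ≤ i → i < b → f i ≤ f (i + 1)) : f a ≤ f b := by
  induction b, hab using Nat.le_induction with
  | base => exact le_rfl
  | succ n hn ih =>
    exact (ih fun i hi hin => h i hi (by omega)).trans (h n hn (by omega))

/-- Consecutive closed intervals `[x (i - 1), x i]`, `a < i ≤ b`, cover `[x a, x b]`. -/
theorem exists_mem_Icc_pred {α : Type*} [LinearOrder α] {x : ℕ → α} {a b : ℕ} (hab : a < b)
    {t : α} (ht : t ∈ Set.Icc (x a) (x b)) :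
    ∃ i, a < i ∧ i ≤ b ∧ t ∈ Set.Icc (x (i - 1)) (x i) := by
  induction b, hab using Nat.le_induction with
  | base => exact ⟨a + 1, by omega, le_rfl, by simpa using ht⟩
  | succ n hn ih =>
    rcases le_total t (x n) with h | h
    · obtain ⟨i, hi, hin, hti⟩ := ih ⟨ht.1, h⟩
      exact ⟨i, hi, by omega, hti⟩
    · exact ⟨n + 1, by omega, le_rfl, by simpa using h, ht.2⟩


/-- A pyramid (histogram region with unimodal heights, apex column `m`) is
r-star-shaped: every point of the base segment `[x (m-1), x m] × {0}` of the apex column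
r-sees every point of `P`. -/
theorem stmt_5 (N : ℕ) (hN : 1 ≤ N) (x c : ℕ → ℝ)
    (hx : ∀ i, i < N → x i < x (i + 1))
    (hcpos : ∀ i, 1 ≤ i → i ≤ N → 0 < c i)
    (hcne : ∀ i, 1 ≤ i → i < N → c i ≠ c (i + 1))
    (P : Set (ℝ × ℝ))
    (hP : P = ⋃ i ∈ Finset.Icc 1 N, Set.Icc (x (i - 1)) (x i) ×ˢ Set.Icc (0 : ℝ) (c i))
    (m : ℕ) (hm1 : 1 ≤ m) (hmN : m ≤ N)
    (hup : ∀ i, 1 ≤ i → i < m → c i < c (i + 1))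
    (hdown : ∀ i, m ≤ i → i < N → c (i + 1) < c i) :
    (∀ s ∈ Set.Icc (x (m - 1)) (x m), ∀ p ∈ P,
        Set.uIcc s p.1 ×ˢ Set.uIcc (0 : ℝ) p.2 ⊆ P) ∧
    ∃ φ ∈ P, ∀ p ∈ P, Set.uIcc φ.1 p.1 ×ˢ Set.uIcc φ.2 p.2 ⊆ P := by
  have hmono : ∀ a b, a ≤ b → b ≤ N → x a ≤ x b := fun a b hab hb =>
    le_of_forall_le_succ hab fun i _ hi => (hx i (by omega)).le
  have hmem : ∀ q : ℝ × ℝ, q ∈ P ↔ ∃ i, (1 ≤ i ∧ i ≤ N) ∧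
      q.1 ∈ Set.Icc (x (i - 1)) (x i) ∧ q.2 ∈ Set.Icc 0 (c i) := by
    intro q
    simp only [hP, Set.mem_iUnion, Finset.mem_Icc, Set.mem_prod, exists_prop]
  have hsees : ∀ s ∈ Set.Icc (x (m - 1)) (x m), ∀ p ∈ P,
      Set.uIcc s p.1 ×ˢ Set.uIcc (0 : ℝ) p.2 ⊆ P := by
    rintro s ⟨hs1, hs2⟩ p hp ⟨u, v⟩ ⟨hu, hv⟩
    obtain ⟨j, ⟨hj1, hjN⟩, ⟨hpj1, hpj2⟩, hp0, hpc⟩ := (hmem p).1 hp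
    rw [Set.uIcc_of_le hp0] at hv
    rw [hmem]
    rcases le_total j m with hjm | hmj
    · have hu' : u ∈ Set.Icc (x (j - 1)) (x m) := Set.uIcc_subset_Icc
        ⟨(hmono _ _ (by omega) (by omega)).trans hs1, hs2⟩
        ⟨hpj1, hpj2.trans (hmono _ _ hjm hmN)⟩ hu
      obtain ⟨i, hi1, him, hui⟩ := exists_mem_Icc_pred (by omega) hu'
      have hc : c j ≤ c i := le_of_forall_le_succ (by omega) fun k hk hki =>
        (hup k (by omega) (by omega)).le
      exact ⟨i, by omega, hui, hv.1, hv.2.trans (hpc.trans hc)⟩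
    · have hu' : u ∈ Set.Icc (x (m - 1)) (x j) := Set.uIcc_subset_Icc
        ⟨hs1, hs2.trans (hmono _ _ hmj hjN)⟩
        ⟨(hmono _ _ (by omega) (by omega)).trans hpj1, hpj2⟩ hu
      obtain ⟨i, hi1, hij, hui⟩ := exists_mem_Icc_pred (by omega) hu'
      have hc : c j ≤ c i := le_of_forall_le_succ (α := ℝᵒᵈ) (f := c) hij fun k hk hkj =>
        (hdown k (by omega) (by omega)).le
      exact ⟨i, by omega, hui, hv.1, hv.2.trans (hpc.trans hc)⟩
  have hbase : x m ∈ Set.Icc (x (m - 1)) (x m) := ⟨hmono _ _ (by omega) hmN, le_rfl⟩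
  exact ⟨hsees, (x m, 0), (hmem _).2 ⟨m, ⟨hm1, hmN⟩, hbase, le_rfl, (hcpos m hm1 hmN).le⟩,
    hsees _ hbase⟩
end

section
/- Let P be a histogram region with breakpoints x_0 < ⋯ < x_N and heights c_1, …, c_N, and let k be the number of tooth columns. Then every set G ⊆ P that guards P (hidden or not) has cardinality at least k. More precisely, for each tooth column i any guard that r-sees some point of the tooth edge [x_{i−1}, x_i] × {c_i} must have its first coordinate in [x_{i−1}, x_i], and the intervals [x_{i−1}, x_i] over distinct tooth columns are pairwise disjoint. -/
theorem breakpoints_lt {N : ℕ} {x : ℕ → ℝ} (hx : ∀ i, i < N → x i < x (i + 1)) {a b : ℕ}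
    (hab : a < b) (hb : b ≤ N) : x a < x b := by
  induction b, hab using Nat.le_induction with
  | base => exact hx a (by omega)
  | succ n hn ih => exact (ih (by omega)).trans (hx n (by omega))

theorem breakpoints_le {N : ℕ} {x : ℕ → ℝ} (hx : ∀ i, i < N → x i < x (i + 1)) {a b : ℕ}
    (hab : a ≤ b) (hb : b ≤ N) : x a ≤ x b := by
  rcases hab.eq_or_lt with rfl | h
  · exact le_rfl
  · exact (breakpoints_lt hx h hb).le

/-- The closed intervals below two distinct tooth columns are disjoint, as teeth are never
adjacent. -/
theorem disjoint_tooth_intervals {N : ℕ} {x c : ℕ → ℝ} (hx : ∀ i, i < N → x i < x (i + 1))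
    {i j : ℕ} (hci : c (i + 1) < c i) (hj : j ≤ N) (hcj : c (j - 1) < c j) (hij : i < j) :
    Disjoint (Set.Icc (x (i - 1)) (x i)) (Set.Icc (x (j - 1)) (x j)) := by
  have hne : j ≠ i + 1 := by
    rintro rfl
    exact lt_asymm hci hcj
  have hlt : x i < x (j - 1) := breakpoints_lt hx (by omega) (by omega)
  rw [Set.disjoint_left]
  intro t ht ht'
  linarith [ht.2, ht'.1]

/-- If the horizontal segment from `(s, c i)` to a point of the edge of the tooth `i` lies in the
histogram, then `s` lies in the interval of the tooth. -/
theorem mem_tooth_interval_of_segment {N : ℕ} {x c : ℕ → ℝ}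
    (hx : ∀ i, i < N → x i < x (i + 1)) {i : ℕ} (hi : 1 ≤ i) (hiN : i ≤ N)
    (hl : c (i - 1) < c i) (hr : c (i + 1) < c i) {s a : ℝ}
    (ha : a ∈ Set.Icc (x (i - 1)) (x i))
    (hseg : ∀ t ∈ Set.uIcc s a, ∃ j, 1 ≤ j ∧ j ≤ N ∧ x (j - 1) ≤ t ∧ t ≤ x j ∧ c i ≤ c j) :
    s ∈ Set.Icc (x (i - 1)) (x i) := by
  constructor
  · by_contra! hs
    have key : ∃ t, s ≤ t ∧ t < x (i - 1) ∧ (2 ≤ i → x (i - 2) < t) := by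
      by_cases h2 : 2 ≤ i
      · have hlt : x (i - 2) < x (i - 1) := breakpoints_lt hx (by omega) (by omega)
        obtain ⟨t, h, h'⟩ := exists_between (max_lt hs hlt)
        exact ⟨t, (le_max_left _ _).trans h.le, h', fun _ => (le_max_right _ _).trans_lt h⟩
      · exact ⟨s, le_rfl, hs, fun h => absurd h h2⟩
    obtain ⟨t, hst, hti, ht2⟩ := key
    obtain ⟨j, hj1, hjN, hjl, hjr, hc⟩ :=
      hseg t (Set.mem_uIcc.2 (Or.inl ⟨hst, hti.le.trans ha.1⟩))
    rcases lt_trichotomy j (i - 1) with h | rfl | h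
    · have := breakpoints_le hx (show j ≤ i - 2 by omega) (by omega)
      linarith [ht2 (by omega)]
    · linarith
    · have := breakpoints_le hx (show i - 1 ≤ j - 1 by omega) (by omega)
      linarith
  · by_contra! hs
    have key : ∃ t, t ≤ s ∧ x i < t ∧ (i + 1 ≤ N → t < x (i + 1)) := by
      by_cases h2 : i + 1 ≤ N
      · obtain ⟨t, h, h'⟩ := exists_between (lt_min hs (hx i h2))
        exact ⟨t, h'.le.trans (min_le_left _ _), h, fun _ => h'.trans_le (min_le_right _ _)⟩
      · exact ⟨s, le_rfl, hs, fun h => absurd h h2⟩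
    obtain ⟨t, hst, hti, ht2⟩ := key
    obtain ⟨j, hj1, hjN, hjl, hjr, hc⟩ :=
      hseg t (Set.mem_uIcc.2 (Or.inr ⟨ha.2.trans hti.le, hst⟩))
    rcases lt_trichotomy j (i + 1) with h | rfl | h
    · have := breakpoints_le hx (show j ≤ i by omega) hiN
      linarith
    · linarith
    · have := breakpoints_le hx (show i + 1 ≤ j - 1 by omega) (by omega)
      linarith [ht2 (by omega)]


/-- In a histogram region with `k` tooth columns, every guard set has at
least `k` elements; any guard r-seeing a point of the tooth edge of tooth column `i` has
first coordinate in `[x (i-1), x i]`, and these intervals are pairwise disjoint over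
distinct tooth columns. -/
theorem stmt_6 (N : ℕ) (hN : 1 ≤ N) (x c : ℕ → ℝ)
    (hx : ∀ i, i < N → x i < x (i + 1))
    (hcpos : ∀ i, 1 ≤ i → i ≤ N → 0 < c i)
    (hcne : ∀ i, 1 ≤ i → i < N → c i ≠ c (i + 1))
    (hc0 : c 0 = 0) (hcN1 : c (N + 1) = 0)
    (P : Set (ℝ × ℝ))
    (hP : P = ⋃ i ∈ Finset.Icc 1 N, Set.Icc (x (i - 1)) (x i) ×ˢ Set.Icc (0 : ℝ) (c i))
    (k : ℕ)
    (hk : k = ((Finset.Icc 1 N).filter (fun i => c (i - 1) < c i ∧ c (i + 1) < c i)).card) :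
    (∀ G ⊆ P, (∀ p ∈ P, ∃ g ∈ G, Set.uIcc g.1 p.1 ×ˢ Set.uIcc g.2 p.2 ⊆ P) →
        (k : ℕ∞) ≤ G.encard) ∧
    (∀ i, 1 ≤ i → i ≤ N → c (i - 1) < c i → c (i + 1) < c i →
        ∀ g ∈ P, (∃ q ∈ Set.Icc (x (i - 1)) (x i) ×ˢ ({c i} : Set ℝ),
            Set.uIcc g.1 q.1 ×ˢ Set.uIcc g.2 q.2 ⊆ P) →
          g.1 ∈ Set.Icc (x (i - 1)) (x i)) ∧
    (∀ i, 1 ≤ i → i ≤ N → c (i - 1) < c i → c (i + 1) < c i →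
        ∀ j, 1 ≤ j → j ≤ N → c (j - 1) < c j → c (j + 1) < c j → i ≠ j →
          Disjoint (Set.Icc (x (i - 1)) (x i)) (Set.Icc (x (j - 1)) (x j))) := by
  have mem_P : ∀ p : ℝ × ℝ, p ∈ P ↔
      ∃ j, (1 ≤ j ∧ j ≤ N) ∧ (x (j - 1) ≤ p.1 ∧ p.1 ≤ x j) ∧ 0 ≤ p.2 ∧ p.2 ≤ c j := by
    intro p
    simp only [hP, Set.mem_iUnion, Finset.mem_Icc, Set.mem_prod, Set.mem_Icc, exists_prop]
  have sees : ∀ i, 1 ≤ i → i ≤ N → c (i - 1) < c i → c (i + 1) < c i →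
      ∀ g ∈ P, (∃ q ∈ Set.Icc (x (i - 1)) (x i) ×ˢ ({c i} : Set ℝ),
          Set.uIcc g.1 q.1 ×ˢ Set.uIcc g.2 q.2 ⊆ P) →
        g.1 ∈ Set.Icc (x (i - 1)) (x i) := by
    rintro i hi hiN hl hr g - ⟨⟨a, b⟩, ⟨ha, rfl : b = c i⟩, hsub⟩
    refine mem_tooth_interval_of_segment hx hi hiN hl hr ha fun t ht => ?_
    obtain ⟨j, ⟨hj1, hjN⟩, ⟨hjl, hjr⟩, -, hc⟩ :=
      (mem_P (t, c i)).1 (hsub ⟨ht, Set.right_mem_uIcc⟩)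
    exact ⟨j, hj1, hjN, hjl, hjr, hc⟩
  have disj : ∀ i, 1 ≤ i → i ≤ N → c (i - 1) < c i → c (i + 1) < c i →
      ∀ j, 1 ≤ j → j ≤ N → c (j - 1) < c j → c (j + 1) < c j → i ≠ j →
        Disjoint (Set.Icc (x (i - 1)) (x i)) (Set.Icc (x (j - 1)) (x j)) := by
    intro i _ hiN hl hr j _ hjN hl' hr' hij
    rcases hij.lt_or_gt with h | h
    · exact disjoint_tooth_intervals hx hr hjN hl' h
    · exact (disjoint_tooth_intervals hx hr' hiN hl h).symm
  refine ⟨fun G hG hguard => ?_, sees, disj⟩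
  choose! f hfG hf using hguard
  have corner_mem : ∀ i, 1 ≤ i → i ≤ N → (x i, c i) ∈ P := fun i hi hiN =>
    (mem_P _).2 ⟨i, ⟨hi, hiN⟩, ⟨breakpoints_le hx (by omega) hiN, le_rfl⟩,
      (hcpos i hi hiN).le, le_rfl⟩
  set T := (Finset.Icc 1 N).filter (fun i => c (i - 1) < c i ∧ c (i + 1) < c i) with hT
  have mem_T : ∀ i, i ∈ T → (1 ≤ i ∧ i ≤ N) ∧ c (i - 1) < c i ∧ c (i + 1) < c i := by
    intro i hi
    simpa [hT] using hi
  have guard_mem : ∀ i ∈ T, (f (x i, c i)).1 ∈ Set.Icc (x (i - 1)) (x i) := by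
    intro i hi
    obtain ⟨⟨hi1, hiN⟩, hl, hr⟩ := mem_T i hi
    have hp := corner_mem i hi1 hiN
    exact sees i hi1 hiN hl hr _ (hG (hfG _ hp))
      ⟨(x i, c i), ⟨⟨breakpoints_le hx (by omega) hiN, le_rfl⟩, rfl⟩, hf _ hp⟩
  have inj : Set.InjOn (fun i => f (x i, c i)) (T : Set ℕ) := by
    intro i hi j hj hij
    by_contra hne
    obtain ⟨⟨hi1, hiN⟩, hl, hr⟩ := mem_T i hi
    obtain ⟨⟨hj1, hjN⟩, hl', hr'⟩ := mem_T j hj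
    have hmem := guard_mem i hi
    rw [show f (x i, c i) = f (x j, c j) from hij] at hmem
    exact Set.disjoint_left.1 (disj i hi1 hiN hl hr j hj1 hjN hl' hr' hne) hmem
      (guard_mem j hj)
  rw [hk, ← Set.encard_coe_eq_coe_finsetCard, ← inj.encard_image]
  refine Set.encard_le_encard ?_
  rintro _ ⟨i, hi, rfl⟩
  obtain ⟨⟨hi1, hiN⟩, -⟩ := mem_T i hi
  exact hfG _ (corner_mem i hi1 hiN)
end

section
/- Let P be a histogram region with breakpoints x_0 < ⋯ < x_N and heights c_1, …, c_N, and let k be the number of tooth columns. Then there exists a set G ⊆ P with exactly k elements such that G guards P and G is hidden: every point of P is r-visible from some g ∈ G, and no two distinct elements of G are r-visible from each other. -/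
/-- The left end of the maximal strictly increasing run of `c` that ends at index `i`. -/
noncomputable def runStart (c : ℕ → ℝ) (i : ℕ) : ℕ :=
  open Classical in Nat.rec 0 (fun j s => if c j < c (j + 1) then s else j + 1) i

theorem runStart_succ_of_lt {c : ℕ → ℝ} {j : ℕ} (h : c j < c (j + 1)) :
    runStart c (j + 1) = runStart c j := by
  simp [runStart, h]

theorem runStart_succ_of_not_lt {c : ℕ → ℝ} {j : ℕ} (h : ¬ c j < c (j + 1)) :
    runStart c (j + 1) = j + 1 := by
  simp [runStart, h]

theorem runStart_le (c : ℕ → ℝ) (i : ℕ) : runStart c i ≤ i := by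
  induction i with
  | zero => simp [runStart]
  | succ j ih =>
    by_cases h : c j < c (j + 1)
    · rw [runStart_succ_of_lt h]; omega
    · rw [runStart_succ_of_not_lt h]

theorem lt_succ_of_runStart_le {c : ℕ → ℝ} {i l : ℕ} (hl : runStart c i ≤ l) (hli : l < i) :
    c l < c (l + 1) := by
  induction i with
  | zero => omega
  | succ j ih =>
    by_cases h : c j < c (j + 1)
    · rw [runStart_succ_of_lt h] at hl
      rcases Nat.lt_succ_iff_lt_or_eq.mp hli with h' | rfl
      · exact ih hl h'
      · exact h
    · rw [runStart_succ_of_not_lt h] at hl; omega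

theorem le_of_forall_lt_succ {c : ℕ → ℝ} {a b : ℕ} (hab : a ≤ b)
    (h : ∀ l, a ≤ l → l < b → c l < c (l + 1)) : c a ≤ c b := by
  induction b, hab using Nat.le_induction with
  | base => exact le_rfl
  | succ b hb ih =>
    exact (ih fun l h₁ h₂ => h l h₁ (by omega)).trans (h b hb (by omega)).le

theorem apply_runStart_le {c : ℕ → ℝ} {b i : ℕ} (hbi : b ≤ i)
    (h : ∀ l, b ≤ l → l < i → c l < c (l + 1)) : c (runStart c i) ≤ c b := by
  induction i, hbi using Nat.le_induction with
  | base =>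
    exact le_of_forall_lt_succ (runStart_le c b) fun l h₁ h₂ => lt_succ_of_runStart_le h₁ h₂
  | succ i hi ih =>
    rw [runStart_succ_of_lt (h i hi (by omega))]
    exact ih fun l h₁ h₂ => h l h₁ (by omega)

/-- A real number can be separated from the larger elements of a finite set. -/
theorem exists_gt_forall_mem_le (S : Finset ℝ) (s : ℝ) :
    ∃ y, s < y ∧ ∀ z ∈ S, s < z → y ≤ z := by
  induction S using Finset.induction_on with
  | empty => exact ⟨s + 1, by linarith, by simp⟩
  | insert a S _ ih =>
    obtain ⟨y, hy, hS⟩ := ih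
    by_cases ha : s < a
    · refine ⟨min y a, lt_min hy ha, fun z hz hsz => ?_⟩
      rcases Finset.mem_insert.mp hz with rfl | hz
      · exact min_le_right _ _
      · exact (min_le_left _ _).trans (hS z hz hsz)
    · refine ⟨y, hy, fun z hz hsz => ?_⟩
      rcases Finset.mem_insert.mp hz with rfl | hz
      · exact absurd hsz ha
      · exact hS z hz hsz

theorem breakpoint_le {x : ℕ → ℝ} {N a b : ℕ} (hx : ∀ i, i < N → x i < x (i + 1))
    (hab : a ≤ b) (hb : b ≤ N) : x a ≤ x b :=
  le_of_forall_lt_succ hab fun l _ h => hx l (by omega)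

/-- Consecutive intervals cover the interval that they span. -/
theorem exists_mem_Icc_of_mem_Icc {x : ℕ → ℝ} {a b : ℕ} (hab : a ≤ b) {t : ℝ}
    (ht : t ∈ Set.Icc (x (a - 1)) (x b)) :
    ∃ l, a ≤ l ∧ l ≤ b ∧ t ∈ Set.Icc (x (l - 1)) (x l) := by
  induction b, hab using Nat.le_induction with
  | base => exact ⟨a, le_rfl, le_rfl, ht⟩
  | succ b hb ih =>
    rcases le_total t (x b) with h | h
    · obtain ⟨l, h₁, h₂, h₃⟩ := ih ⟨ht.1, h⟩
      exact ⟨l, h₁, by omega, h₃⟩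
    · exact ⟨b + 1, by omega, le_rfl, by simpa using h, ht.2⟩

/-- Every column of a histogram is reached, at its full height, by a tooth whose ascending left
flank starts below that height. -/
theorem exists_tooth {N : ℕ} {c : ℕ → ℝ} (hcpos : ∀ i, 1 ≤ i → i ≤ N → 0 < c i)
    (hcne : ∀ i, 1 ≤ i → i < N → c i ≠ c (i + 1)) (hc0 : c 0 = 0) (hcN1 : c (N + 1) = 0)
    {m : ℕ} (hm : 1 ≤ m) (hmN : m ≤ N) :
    ∃ i, 1 ≤ i ∧ i ≤ N ∧ c (i - 1) < c i ∧ c (i + 1) < c i ∧ c (runStart c i) < c m ∧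
      ∀ l, min i m ≤ l → l ≤ max i m → c m ≤ c l := by
  classical
  have h0 : c 0 < c m := hc0 ▸ hcpos m hm hmN
  obtain ⟨b, hb, hbm, hlow⟩ : ∃ b, c b < c m ∧ b < m ∧ ∀ l, b < l → l ≤ m → c m ≤ c l := by
    have hb : c (Nat.findGreatest (fun l => c l < c m) m) < c m :=
      Nat.findGreatest_spec (P := fun l => c l < c m) (Nat.zero_le m) h0
    refine ⟨_, hb, lt_of_le_of_ne (Nat.findGreatest_le m) fun h => ?_, fun l h₁ h₂ => ?_⟩
    · rw [h] at hb; exact lt_irrefl _ hb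
    · exact not_lt.mp (Nat.findGreatest_is_greatest h₁ h₂)
  have hN : ¬ c N < c (N + 1) := by
    rw [hcN1]; exact not_lt.mpr (hcpos N (by omega) le_rfl).le
  have hex : ∃ i, b < i ∧ ¬ c i < c (i + 1) := ⟨N, by omega, hN⟩
  obtain ⟨i, ⟨hbi, hi⟩, hiN, hmin⟩ : ∃ i, (b < i ∧ ¬ c i < c (i + 1)) ∧ i ≤ N ∧
      ∀ l, l < i → ¬ (b < l ∧ ¬ c l < c (l + 1)) :=
    ⟨Nat.find hex, Nat.find_spec hex, Nat.find_min' hex ⟨by omega, hN⟩,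
      fun l hl => Nat.find_min hex hl⟩
  have hrun : ∀ l, b ≤ l → l < i → c l < c (l + 1) := fun l h₁ h₂ => by
    rcases h₁.eq_or_lt with rfl | h₁
    · exact hb.trans_le (hlow _ (by omega) (by omega))
    · by_contra h; exact hmin l h₂ ⟨h₁, h⟩
  refine ⟨i, by omega, hiN, ?_, ?_, (apply_runStart_le hbi.le hrun).trans_lt hb, ?_⟩
  · have := hrun (i - 1) (by omega) (by omega)
    rwa [Nat.sub_add_cancel (by omega)] at this
  · rcases hiN.eq_or_lt with rfl | h
    · rw [hcN1]; exact hcpos _ (by omega) le_rfl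
    · exact lt_of_le_of_ne (not_lt.mp hi) (hcne i (by omega) h).symm
  · intro l h₁ h₂
    rcases le_total l m with h | h
    · exact hlow l (by omega) h
    · exact le_of_forall_lt_succ h fun n _ _ => hrun n (by omega) (by omega)

/-- Between two teeth lies the column where the ascending left flank of the second one starts. -/
theorem lt_runStart_of_tooth {c : ℕ → ℝ} {i j : ℕ} (hji : j < i) (hj : c (j + 1) < c j) :
    j < runStart c i :=
  lt_of_not_ge fun h => lt_asymm hj (lt_succ_of_runStart_le h hji)

theorem runStart_lt_of_tooth {c : ℕ → ℝ} {i : ℕ} (hi1 : 1 ≤ i) (hi : c (i - 1) < c i) :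
    runStart c i < i := by
  obtain ⟨j, rfl⟩ := Nat.exists_eq_succ_of_ne_zero (Nat.one_le_iff_ne_zero.mp hi1)
  rw [Nat.succ_eq_add_one, runStart_succ_of_lt (by simpa using hi)]
  exact Nat.lt_succ_of_le (runStart_le c j)

/-- A histogram region with `k` tooth columns admits a hidden guard set with
exactly `k` elements: it guards all of `P` and no two distinct guards r-see each other. -/
theorem stmt_7 (N : ℕ) (hN : 1 ≤ N) (x c : ℕ → ℝ)
    (hx : ∀ i, i < N → x i < x (i + 1))
    (hcpos : ∀ i, 1 ≤ i → i ≤ N → 0 < c i)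
    (hcne : ∀ i, 1 ≤ i → i < N → c i ≠ c (i + 1))
    (hc0 : c 0 = 0) (hcN1 : c (N + 1) = 0)
    (P : Set (ℝ × ℝ))
    (hP : P = ⋃ i ∈ Finset.Icc 1 N, Set.Icc (x (i - 1)) (x i) ×ˢ Set.Icc (0 : ℝ) (c i))
    (k : ℕ)
    (hk : k = ((Finset.Icc 1 N).filter (fun i => c (i - 1) < c i ∧ c (i + 1) < c i)).card) :
    ∃ G : Finset (ℝ × ℝ), G.card = k ∧ ↑G ⊆ P ∧
      (∀ p ∈ P, ∃ g ∈ G, Set.uIcc g.1 p.1 ×ˢ Set.uIcc g.2 p.2 ⊆ P) ∧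
      (∀ g ∈ G, ∀ g' ∈ G, g ≠ g' →
        ¬ Set.uIcc g.1 g'.1 ×ˢ Set.uIcc g.2 g'.2 ⊆ P) := by
  classical
  have hmem : ∀ p : ℝ × ℝ, p ∈ P ↔ ∃ l, 1 ≤ l ∧ l ≤ N ∧ p.1 ∈ Set.Icc (x (l - 1)) (x l) ∧
      p.2 ∈ Set.Icc 0 (c l) := by
    intro p
    simp only [hP, Set.mem_iUnion, Set.mem_prod, Finset.mem_Icc, exists_prop, and_assoc]
  choose y hy hyle using exists_gt_forall_mem_le ((Finset.Icc 1 N).image c)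
  have hyc : ∀ s l, 1 ≤ l → l ≤ N → s < c l → y s ≤ c l := fun s l h₁ h₂ h =>
    hyle s _ (Finset.mem_image_of_mem c (Finset.mem_Icc.mpr ⟨h₁, h₂⟩)) h
  have hc_nonneg : ∀ l, l ≤ N → 0 ≤ c l := fun l hl => by
    rcases Nat.eq_zero_or_pos l with rfl | h
    · exact hc0.ge
    · exact (hcpos l h hl).le
  let T := (Finset.Icc 1 N).filter (fun i => c (i - 1) < c i ∧ c (i + 1) < c i)
  have hT : ∀ i, i ∈ T ↔ (1 ≤ i ∧ i ≤ N) ∧ c (i - 1) < c i ∧ c (i + 1) < c i := by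
    simp [T]
  let g : ℕ → ℝ × ℝ := fun i => (x i, y (c (runStart c i)))
  have hy_nonneg : ∀ i, i ≤ N → 0 ≤ y (c (runStart c i)) := fun i hi =>
    (hc_nonneg _ ((runStart_le c i).trans hi)).trans (hy _).le
  have hxlt : ∀ a b, a < b → b ≤ N → x a < x b := fun a b hab hb =>
    (hx a (by omega)).trans_le (breakpoint_le hx hab hb)
  have hinj : Set.InjOn g T := by
    intro i hi j hj hij
    have hi' := (hT i).mp hi
    have hj' := (hT j).mp hj
    have h : x i = x j := congrArg Prod.fst hij
    rcases lt_trichotomy i j with h' | h' | h'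
    · exact absurd h (hxlt i j h' hj'.1.2).ne
    · exact h'
    · exact absurd h (hxlt j i h' hi'.1.2).ne'
  have hidden : ∀ i ∈ T, ∀ j ∈ T, j < i →
      ¬ Set.uIcc (g i).1 (g j).1 ×ˢ Set.uIcc (g i).2 (g j).2 ⊆ P := by
    intro i hi j hj hji hsub
    obtain ⟨⟨hi1, hiN⟩, hil, -⟩ := (hT i).mp hi
    obtain ⟨-, -, hjr⟩ := (hT j).mp hj
    have hjv := lt_runStart_of_tooth hji hjr
    have hvi := runStart_lt_of_tooth hi1 hil
    have hyv := hy (c (runStart c i))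
    set v := runStart c i with hv
    have hvx := hxlt (v - 1) v (by omega) (by omega)
    have h₁ := breakpoint_le hx (show j ≤ v - 1 by omega) (by omega)
    have h₂ := breakpoint_le hx hvi.le hiN
    have hq : ((x (v - 1) + x v) / 2, y (c v)) ∈ P := by
      refine hsub ⟨Set.mem_uIcc.mpr (Or.inr ⟨?_, ?_⟩), Set.left_mem_uIcc⟩
      · change x j ≤ (x (v - 1) + x v) / 2
        linarith
      · change (x (v - 1) + x v) / 2 ≤ x i
        linarith
    obtain ⟨l, hl1, hlN, ⟨hl, hl'⟩, -, hle⟩ := (hmem _).mp hq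
    simp only at hl hl' hle
    rcases lt_trichotomy l v with h | rfl | h
    · have := breakpoint_le hx (show l ≤ v - 1 by omega) (by omega)
      linarith
    · linarith
    · have := breakpoint_le hx (show v ≤ l - 1 by omega) (by omega)
      linarith
  refine ⟨T.image g, ?_, ?_, ?_, ?_⟩
  · rw [Finset.card_image_of_injOn hinj, hk]
  · intro p hp
    obtain ⟨i, hi, rfl⟩ := Finset.mem_image.mp (Finset.mem_coe.mp hp)
    obtain ⟨⟨hi1, hiN⟩, hil, -⟩ := (hT i).mp hi
    have hvi := runStart_lt_of_tooth hi1 hil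
    refine (hmem _).mpr ⟨i, hi1, hiN, ⟨(hxlt _ _ (by omega) hiN).le, le_rfl⟩,
      hy_nonneg i hiN, hyc _ i hi1 hiN ?_⟩
    exact (lt_succ_of_runStart_le le_rfl hvi).trans_le
      (le_of_forall_lt_succ hvi fun l h₁ h₂ => lt_succ_of_runStart_le (by omega) h₂)
  · intro p hp
    obtain ⟨m, hm1, hmN, hp1, hp2⟩ := (hmem p).mp hp
    obtain ⟨i, hi1, hiN, hil, hir, hvm, hlow⟩ := exists_tooth hcpos hcne hc0 hcN1 hm1 hmN
    refine ⟨g i, Finset.mem_image_of_mem g ((hT i).mpr ⟨⟨hi1, hiN⟩, hil, hir⟩), ?_⟩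
    rintro q ⟨hq1, hq2⟩
    have hspan : Set.uIcc (g i).1 p.1 ⊆ Set.Icc (x (min i m - 1)) (x (max i m)) := by
      refine Set.uIcc_subset_Icc ⟨?_, ?_⟩ ⟨?_, ?_⟩
      · exact breakpoint_le hx (by omega) hiN
      · exact breakpoint_le hx (by omega) (by omega)
      · exact (breakpoint_le hx (by omega) (by omega)).trans hp1.1
      · exact hp1.2.trans (breakpoint_le hx (by omega) (by omega))
    have hheight : Set.uIcc (g i).2 p.2 ⊆ Set.Icc 0 (c m) :=
      Set.uIcc_subset_Icc ⟨hy_nonneg i hiN, hyc _ m hm1 hmN hvm⟩ hp2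
    obtain ⟨l, h₁, h₂, h₃⟩ := exists_mem_Icc_of_mem_Icc (min_le_max (a := i)) (hspan hq1)
    have hq := hheight hq2
    exact (hmem q).mpr ⟨l, by omega, by omega, h₃, hq.1, hq.2.trans (hlow l h₁ h₂)⟩
  · intro p hp p' hp' hne
    obtain ⟨i, hi, rfl⟩ := Finset.mem_image.mp hp
    obtain ⟨j, hj, rfl⟩ := Finset.mem_image.mp hp'
    rcases lt_trichotomy i j with h | rfl | h
    · rw [Set.uIcc_comm (g i).1, Set.uIcc_comm (g i).2]
      exact hidden j hj i hi h
    · exact absurd rfl hne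
    · exact hidden i hi j hj h
end

section
/- Let P be a histogram region with breakpoints x_0 < ⋯ < x_N and heights c_1, …, c_N, and let k be the number of tooth columns. Then the minimum cardinality of a hidden guard set of P equals the minimum cardinality of a guard set of P, and both equal k: there is a hidden guard set of size k, and every guard set (hidden or not) has at least k elements. In particular, for histogram regions under orthogonal visibility the hiddenness constraint does not increase the optimal number of guards. -/
/-- The histogram region with breakpoints `x` and column heights `c`. -/
def histogram (N : ℕ) (x c : ℕ → ℝ) : Set (ℝ × ℝ) :=
  ⋃ i ∈ Finset.Icc 1 N, Set.Icc (x (i - 1)) (x i) ×ˢ Set.Icc (0 : ℝ) (c i)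

/-- The indices of the tooth columns of a histogram. -/
noncomputable def teeth (N : ℕ) (c : ℕ → ℝ) : Finset ℕ :=
  (Finset.Icc 1 N).filter (fun i => c (i - 1) < c i ∧ c (i + 1) < c i)

lemma mem_histogram {N : ℕ} {x c : ℕ → ℝ} {p : ℝ × ℝ} :
    p ∈ histogram N x c ↔ ∃ i, 1 ≤ i ∧ i ≤ N ∧ x (i - 1) ≤ p.1 ∧ p.1 ≤ x i ∧ 0 ≤ p.2 ∧
      p.2 ≤ c i := by
  simp only [histogram, Set.mem_iUnion, Finset.mem_Icc, Set.mem_prod, Set.mem_Icc, exists_prop]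
  grind

lemma mem_teeth {N : ℕ} {c : ℕ → ℝ} {i : ℕ} :
    i ∈ teeth N c ↔ 1 ≤ i ∧ i ≤ N ∧ c (i - 1) < c i ∧ c (i + 1) < c i := by
  simp [teeth, and_assoc]

lemma breakpoint_lt {N : ℕ} {x : ℕ → ℝ} (hx : ∀ i, i < N → x i < x (i + 1)) {i j : ℕ}
    (hij : i < j) (hj : j ≤ N) : x i < x j := by
  induction j, hij using Nat.le_induction with
  | base => exact hx i hj
  | succ j _ ih => exact (ih (by omega)).trans (hx j hj)

lemma breakpoint_le_s8 {N : ℕ} {x : ℕ → ℝ} (hx : ∀ i, i < N → x i < x (i + 1)) {i j : ℕ}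
    (hij : i ≤ j) (hj : j ≤ N) : x i ≤ x j := by
  rcases hij.eq_or_lt with rfl | h
  · exact le_rfl
  · exact (breakpoint_lt hx h hj).le

lemma exists_column {x : ℕ → ℝ} {s : ℝ} {l r : ℕ} (hlr : l < r) (hl : x l ≤ s) (hr : s ≤ x r) :
    ∃ a, l < a ∧ a ≤ r ∧ x (a - 1) ≤ s ∧ s ≤ x a := by
  induction r, hlr using Nat.le_induction with
  | base => exact ⟨l + 1, by omega, le_rfl, by simpa using hl, hr⟩
  | succ r _ ih =>
    by_cases h : s ≤ x r
    · obtain ⟨a, h1, h2, h3⟩ := ih h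
      exact ⟨a, h1, by omega, h3⟩
    · exact ⟨r + 1, by omega, le_rfl, by simpa using (not_le.mp h).le, hr⟩

/-- Over the interior of a column the region is no higher than that column. -/
lemma snd_le_of_mem_histogram {N : ℕ} {x c : ℕ → ℝ} (hx : ∀ i, i < N → x i < x (i + 1))
    {v : ℕ} (hv : v ≤ N) {s t : ℝ} (hl : x (v - 1) < s) (hr : s < x v)
    (h : (s, t) ∈ histogram N x c) : t ≤ c v := by
  obtain ⟨i, h1, h2, h3, h4, -, h6⟩ := mem_histogram.mp h
  dsimp only at h3 h4 h6
  rcases lt_trichotomy i v with hiv | rfl | hiv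
  · have := breakpoint_le_s8 hx (show i ≤ v - 1 by omega) (by omega)
    linarith
  · exact h6
  · have := breakpoint_le_s8 hx (show v ≤ i - 1 by omega) (by omega)
    linarith

/-- Two points are visible when all the columns between them are high enough. -/
lemma rect_subset_histogram {N : ℕ} {x c : ℕ → ℝ} (hx : ∀ i, i < N → x i < x (i + 1))
    {i j : ℕ} (hi : i ∈ Finset.Icc 1 N) (hj : j ∈ Finset.Icc 1 N) {p q : ℝ × ℝ}
    (hp : p.1 ∈ Set.Icc (x (i - 1)) (x i)) (hq : q.1 ∈ Set.Icc (x (j - 1)) (x j))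
    (hp0 : 0 ≤ p.2) (hq0 : 0 ≤ q.2) (h : ∀ a ∈ Set.uIcc i j, p.2 ≤ c a ∧ q.2 ≤ c a) :
    Set.uIcc p.1 q.1 ×ˢ Set.uIcc p.2 q.2 ⊆ histogram N x c := by
  rintro ⟨s, t⟩ ⟨hs, ht⟩
  simp only [Finset.mem_Icc] at hi hj
  simp only [Set.mem_Icc] at hp hq
  simp only [Set.mem_uIcc] at hs ht h
  have e1 := breakpoint_le_s8 hx (show min i j - 1 ≤ i - 1 by omega) (by omega)
  have e2 := breakpoint_le_s8 hx (show min i j - 1 ≤ j - 1 by omega) (by omega)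
  have e3 := breakpoint_le_s8 hx (show i ≤ max i j by omega) (by omega)
  have e4 := breakpoint_le_s8 hx (show j ≤ max i j by omega) (by omega)
  obtain ⟨a, h1, h2, h3, h4⟩ := exists_column (x := x) (s := s)
    (show min i j - 1 < max i j by omega)
    (by rcases hs with hs | hs <;> linarith) (by rcases hs with hs | hs <;> linarith)
  have ha := h a (by omega)
  refine mem_histogram.mpr ⟨a, by omega, by omega, h3, h4, ?_, ?_⟩ <;>
    rcases ht with ht | ht <;> dsimp only <;> linarith

/-- Every column `j` reaches some tooth through columns at least as high as `j`. -/
lemma exists_tooth_s8 {N : ℕ} {c : ℕ → ℝ} (hcpos : ∀ i, 1 ≤ i → i ≤ N → 0 < c i)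
    (hcne : ∀ i, 1 ≤ i → i < N → c i ≠ c (i + 1)) (hc0 : c 0 = 0) (hcN1 : c (N + 1) = 0)
    {j : ℕ} (hj : j ∈ Finset.Icc 1 N) :
    ∃ i ∈ teeth N c, ∀ a ∈ Set.uIcc i j, c j ≤ c a := by
  classical
  let S := (Finset.Icc 1 N).filter (fun i => ∀ a ∈ Set.uIcc i j, c j ≤ c a)
  have hjS : j ∈ S := by simp [S, Finset.mem_Icc.mp hj]
  obtain ⟨i, hiS, hmax⟩ := S.exists_max_image c ⟨j, hjS⟩
  have hi := hiS
  simp only [S, Finset.mem_filter, Finset.mem_Icc] at hi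
  obtain ⟨⟨hi1, hiN⟩, hreach⟩ := hi
  have key : ∀ m, (m = i + 1 ∨ i = m + 1) → 1 ≤ m → m ≤ N → c m ≠ c i → c m < c i := by
    intro m hm h1 h2 hne
    by_cases hmS : m ∈ S
    · exact lt_of_le_of_ne (hmax m hmS) hne
    · by_contra hlt
      apply hmS
      simp only [S, Finset.mem_filter, Finset.mem_Icc]
      refine ⟨⟨h1, h2⟩, fun a ha => ?_⟩
      rw [Set.mem_uIcc] at ha
      by_cases ham : a = m
      · subst ham
        exact (hreach i (by simp)).trans (not_lt.mp hlt)
      · exact hreach a (by rw [Set.mem_uIcc]; omega)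
  have hpos := hcpos i hi1 hiN
  refine ⟨i, mem_teeth.mpr ⟨hi1, hiN, ?_, ?_⟩, hreach⟩
  · obtain rfl | h := hi1.eq_or_lt
    · simpa [hc0] using hpos
    · refine key (i - 1) (by omega) (by omega) (by omega) ?_
      have := hcne (i - 1) (by omega) (by omega)
      rwa [show i - 1 + 1 = i by omega] at this
  · obtain rfl | h := hiN.eq_or_lt
    · simpa [hcN1] using hpos
    · exact key (i + 1) (by omega) (by omega) (by omega) (hcne i hi1 h).symm

/-- The guard of tooth `i` is placed just above the lowest column between `i` and the previous
tooth: then no earlier tooth column is visible from it, and it covers every column whose reach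
has `i` as leftmost tooth. -/
lemma exists_guard_height {N : ℕ} {c : ℕ → ℝ} (hcpos : ∀ i, 1 ≤ i → i ≤ N → 0 < c i)
    (hc0 : c 0 = 0) {i : ℕ} (hi : i ∈ teeth N c) :
    ∃ h, 0 < h ∧ h ≤ c i ∧ (∀ p ∈ teeth N c, p < i → ∃ v, p < v ∧ v < i ∧ c v < h) ∧
      ∀ j ∈ Finset.Icc 1 N, c j < h → ∃ p ∈ teeth N c, p < i ∧ ∀ a ∈ Set.Icc p i, c j ≤ c a := by
  classical
  obtain ⟨hi1, hiN, hil, -⟩ := mem_teeth.mp hi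
  obtain ⟨p, hpi, hp, hlast⟩ : ∃ p < i, (p = 0 ∨ p ∈ teeth N c) ∧
      ∀ q ∈ teeth N c, q < i → q ≤ p := by
    let T := insert 0 ((teeth N c).filter (· < i))
    obtain ⟨p, hp, hmax⟩ := T.exists_max_image id ⟨0, by simp [T]⟩
    simp only [T, Finset.mem_insert, Finset.mem_filter] at hp
    refine ⟨p, by omega, by tauto, fun q hq hqi => hmax q ?_⟩
    simp [T, hq, hqi]
  obtain ⟨v, hv, hmin⟩ := (Finset.Icc p i).exists_min_image c ⟨i, by simp; omega⟩
  simp only [Finset.mem_Icc] at hv hmin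
  have hvi : c v < c i := (hmin (i - 1) (by omega)).trans_lt hil
  have hvi' : v < i := lt_of_le_of_ne hv.2 (by rintro rfl; exact lt_irrefl _ hvi)
  have hv0 : 0 ≤ c v := by
    rcases Nat.eq_zero_or_pos v with rfl | h
    · exact hc0.ge
    · exact (hcpos v h (by omega)).le
  obtain ⟨m, hm, hmmin⟩ := ((Finset.Icc 1 N).filter (fun j => c v < c j)).exists_min_image c
    ⟨i, by simp [hi1, hiN, hvi]⟩
  simp only [Finset.mem_filter, Finset.mem_Icc] at hm hmmin
  refine ⟨c m, hv0.trans_lt hm.2, hmmin i ⟨⟨hi1, hiN⟩, hvi⟩, fun q hq hqi => ?_, fun j hj hjm => ?_⟩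
  · have hqp := hlast q hq hqi
    have hq1 := (mem_teeth.mp hq).1
    have hpT : p ∈ teeth N c := hp.resolve_left (by omega)
    have hpv : p ≠ v := by
      rintro rfl
      exact absurd (hmin (p + 1) (by omega)) (not_le.mpr (mem_teeth.mp hpT).2.2.2)
    exact ⟨v, by omega, hvi', hm.2⟩
  · rw [Finset.mem_Icc] at hj
    have hjv : c j ≤ c v := by
      by_contra h
      exact absurd (hmmin j ⟨hj, not_le.mp h⟩) (not_le.mpr hjm)
    refine ⟨p, hp.resolve_left ?_, hpi, fun a ha => hjv.trans (hmin a ha)⟩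
    rintro rfl
    have := hmin 0 (by omega)
    have := hcpos j hj.1 hj.2
    linarith

/-- A guard that sees the middle of the top edge of a tooth lies in that tooth column. -/
lemma guard_mem_tooth_column {N : ℕ} {x c : ℕ → ℝ} (hx : ∀ i, i < N → x i < x (i + 1))
    {i : ℕ} (hi : i ∈ teeth N c) {g : ℝ × ℝ} (hg : g ∈ histogram N x c)
    (hvis : Set.uIcc g.1 ((x (i - 1) + x i) / 2) ×ˢ Set.uIcc g.2 (c i) ⊆ histogram N x c) :
    g.1 ∈ Set.Icc (x (i - 1)) (x i) := by
  obtain ⟨hi1, hiN, hl, hr⟩ := mem_teeth.mp hi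
  obtain ⟨b, hb1, hbN, hbl, hbr, -, -⟩ := mem_histogram.mp hg
  have hxi := breakpoint_lt hx (show i - 1 < i by omega) hiN
  constructor
  · by_contra! hlt
    have hi2 : 1 < i := by
      by_contra h
      have := breakpoint_le_s8 hx (show i - 1 ≤ b - 1 by omega) (by omega)
      linarith
    have hx' := breakpoint_lt hx (show i - 1 - 1 < i - 1 by omega) (by omega)
    obtain ⟨s, hs1, hs2⟩ := exists_between (max_lt hlt hx')
    have := snd_le_of_mem_histogram hx (by omega) ((le_max_right _ _).trans_lt hs1) hs2
      (hvis (show (s, c i) ∈ _ from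
        ⟨Set.mem_uIcc_of_le ((le_max_left _ _).trans hs1.le) (by dsimp only; linarith),
          Set.right_mem_uIcc⟩))
    linarith
  · by_contra! hlt
    have hi2 : i < N := by
      by_contra h
      have := breakpoint_le_s8 hx (show b ≤ i by omega) (by omega)
      linarith
    obtain ⟨s, hs1, hs2⟩ := exists_between (lt_min hlt (hx i hi2))
    have := snd_le_of_mem_histogram hx (v := i + 1) (by omega) (by simpa using hs1)
      (hs2.trans_le (min_le_right _ _))
      (hvis (show (s, c i) ∈ _ from
        ⟨Set.mem_uIcc_of_ge (by dsimp only; linarith) (hs2.le.trans (min_le_left _ _)),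
          Set.right_mem_uIcc⟩))
    linarith

lemma disjoint_tooth_columns {N : ℕ} {x c : ℕ → ℝ} (hx : ∀ i, i < N → x i < x (i + 1))
    {i j : ℕ} (hi : i ∈ teeth N c) (hj : j ∈ teeth N c) (hij : i < j) :
    x i < x (j - 1) := by
  rw [mem_teeth] at hi hj
  refine breakpoint_lt hx ?_ (by omega)
  by_contra h
  obtain rfl : j = i + 1 := by omega
  exact absurd hi.2.2.2 (not_lt.mpr (by simpa using hj.2.2.1.le))

theorem exists_hidden_guards {N : ℕ} {x c : ℕ → ℝ}
    (hx : ∀ i, i < N → x i < x (i + 1))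
    (hcpos : ∀ i, 1 ≤ i → i ≤ N → 0 < c i)
    (hcne : ∀ i, 1 ≤ i → i < N → c i ≠ c (i + 1))
    (hc0 : c 0 = 0) (hcN1 : c (N + 1) = 0) :
    ∃ G : Finset (ℝ × ℝ), G.card = (teeth N c).card ∧ ↑G ⊆ histogram N x c ∧
      (∀ p ∈ histogram N x c,
        ∃ g ∈ G, Set.uIcc g.1 p.1 ×ˢ Set.uIcc g.2 p.2 ⊆ histogram N x c) ∧
      (∀ g ∈ G, ∀ g' ∈ G, g ≠ g' →
        ¬ Set.uIcc g.1 g'.1 ×ˢ Set.uIcc g.2 g'.2 ⊆ histogram N x c) := by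
  classical
  have hex : ∀ i, ∃ h, i ∈ teeth N c → _ := fun i => by
    by_cases hi : i ∈ teeth N c
    · obtain ⟨h, hh⟩ := exists_guard_height hcpos hc0 hi
      exact ⟨h, fun _ => hh⟩
    · exact ⟨0, fun h => absurd h hi⟩
  choose h hh using hex
  let f : ℕ → ℝ × ℝ := fun i => ((x (i - 1) + x i) / 2, h i)
  have hmid : ∀ i, 1 ≤ i → i ≤ N → x (i - 1) < (f i).1 ∧ (f i).1 < x i := by
    intro i h1 h2
    have := breakpoint_lt hx (show i - 1 < i by omega) h2
    constructor <;> simp only [f] <;> linarith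
  have hlt : ∀ i ∈ teeth N c, ∀ j ∈ teeth N c, i < j → (f i).1 < (f j).1 := by
    intro i hi j hj hij
    have := disjoint_tooth_columns hx hi hj hij
    rw [mem_teeth] at hi hj
    linarith [(hmid i hi.1 hi.2.1).2, (hmid j hj.1 hj.2.1).1]
  have hhid : ∀ i ∈ teeth N c, ∀ j ∈ teeth N c, i < j →
      ¬ Set.uIcc (f i).1 (f j).1 ×ˢ Set.uIcc (f i).2 (f j).2 ⊆ histogram N x c := by
    intro i hi j hj hij hsub
    obtain ⟨v, hiv, hvj, hvh⟩ := (hh j hj).2.2.1 i hi hij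
    rw [mem_teeth] at hi hj
    have hv := hmid v (by omega) (by omega)
    have h1 := breakpoint_le_s8 hx (show i ≤ v - 1 by omega) (by omega)
    have h2 := breakpoint_le_s8 hx (show v ≤ j - 1 by omega) (by omega)
    have := snd_le_of_mem_histogram hx (by omega) hv.1 hv.2
      (hsub (show ((f v).1, h j) ∈ _ from ⟨Set.mem_uIcc_of_le
        (by dsimp only; linarith [(hmid i hi.1 hi.2.1).2])
        (by dsimp only; linarith [(hmid j hj.1 hj.2.1).1]), Set.right_mem_uIcc⟩))
    linarith
  refine ⟨(teeth N c).image f, Finset.card_image_of_injOn ?_, ?_, ?_, ?_⟩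
  · intro i hi j hj hij
    by_contra hne
    rcases lt_or_gt_of_ne hne with hl | hl
    · exact (hlt i hi j hj hl).ne (congrArg Prod.fst hij)
    · exact (hlt j hj i hi hl).ne' (congrArg Prod.fst hij)
  · intro g hg
    obtain ⟨i, hi, rfl⟩ := Finset.mem_image.mp (Finset.mem_coe.mp hg)
    have hi' := mem_teeth.mp hi
    have hm := hmid i hi'.1 hi'.2.1
    exact mem_histogram.mpr ⟨i, hi'.1, hi'.2.1, hm.1.le, hm.2.le, (hh i hi).1.le, (hh i hi).2.1⟩
  · intro p hp
    obtain ⟨j, hj1, hjN, hjl, hjr, hp0, hpc⟩ := mem_histogram.mp hp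
    have hj : j ∈ Finset.Icc 1 N := Finset.mem_Icc.mpr ⟨hj1, hjN⟩
    have hne : ((teeth N c).filter (fun i => ∀ a ∈ Set.uIcc i j, c j ≤ c a)).Nonempty := by
      obtain ⟨i, hi, hr⟩ := exists_tooth_s8 hcpos hcne hc0 hcN1 hj
      exact ⟨i, Finset.mem_filter.mpr ⟨hi, hr⟩⟩
    obtain ⟨i, hi, hmin⟩ := Finset.exists_min_image _ id hne
    obtain ⟨hi, hreach⟩ := Finset.mem_filter.mp hi
    have hi' := mem_teeth.mp hi
    have hm := hmid i hi'.1 hi'.2.1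
    have hhj : h i ≤ c j := by
      by_contra! hlt'
      obtain ⟨q, hq, hqi, hqr⟩ := (hh i hi).2.2.2 j hj hlt'
      refine absurd (hmin q (Finset.mem_filter.mpr ⟨hq, fun a ha => ?_⟩)) (not_le.mpr hqi)
      by_cases hai : a ∈ Set.Icc q i
      · exact hqr a hai
      · refine hreach a ?_
        rw [Set.mem_uIcc] at ha ⊢
        rw [Set.mem_Icc] at hai
        omega
    exact ⟨f i, Finset.mem_image_of_mem f hi, rect_subset_histogram hx
      (Finset.mem_Icc.mpr ⟨hi'.1, hi'.2.1⟩) hj ⟨hm.1.le, hm.2.le⟩ ⟨hjl, hjr⟩ (hh i hi).1.le hp0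
      fun a ha => ⟨hhj.trans (hreach a ha), hpc.trans (hreach a ha)⟩⟩
  · intro g hg g' hg' hne
    obtain ⟨i, hi, rfl⟩ := Finset.mem_image.mp hg
    obtain ⟨j, hj, rfl⟩ := Finset.mem_image.mp hg'
    rcases lt_or_gt_of_ne (fun e : i = j => hne (congrArg f e)) with hl | hl
    · exact hhid i hi j hj hl
    · rw [Set.uIcc_comm (f i).1, Set.uIcc_comm (f i).2]
      exact hhid j hj i hi hl

theorem card_teeth_le_encard_of_guards {N : ℕ} {x c : ℕ → ℝ}
    (hx : ∀ i, i < N → x i < x (i + 1)) (hcpos : ∀ i, 1 ≤ i → i ≤ N → 0 < c i)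
    {G : Set (ℝ × ℝ)} (hG : G ⊆ histogram N x c)
    (hguard : ∀ p ∈ histogram N x c,
      ∃ g ∈ G, Set.uIcc g.1 p.1 ×ˢ Set.uIcc g.2 p.2 ⊆ histogram N x c) :
    ((teeth N c).card : ℕ∞) ≤ G.encard := by
  have hex : ∀ i, ∃ g, i ∈ teeth N c → g ∈ G ∧ g.1 ∈ Set.Icc (x (i - 1)) (x i) := fun i => by
    by_cases hi : i ∈ teeth N c
    · have hi' := mem_teeth.mp hi
      have hxi := breakpoint_lt hx (show i - 1 < i by omega) hi'.2.1
      obtain ⟨g, hg, hvis⟩ := hguard ((x (i - 1) + x i) / 2, c i)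
        (mem_histogram.mpr ⟨i, hi'.1, hi'.2.1, by dsimp only; linarith, by dsimp only; linarith,
          (hcpos i hi'.1 hi'.2.1).le, le_rfl⟩)
      exact ⟨g, fun _ => ⟨hg, guard_mem_tooth_column hx hi (hG hg) hvis⟩⟩
    · exact ⟨0, fun h => absurd h hi⟩
  choose g hg using hex
  have hlt : ∀ i ∈ teeth N c, ∀ j ∈ teeth N c, i < j → (g i).1 < (g j).1 :=
    fun i hi j hj hij => ((hg i hi).2.2.trans_lt (disjoint_tooth_columns hx hi hj hij)).trans_le
      (hg j hj).2.1
  rw [← Set.encard_coe_eq_coe_finsetCard]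
  refine Set.encard_le_encard_of_injOn (f := g) (fun i hi => (hg i hi).1) ?_
  intro i hi j hj hij
  by_contra hne
  rcases lt_or_gt_of_ne hne with hl | hl
  · exact (hlt i hi j hj hl).ne (congrArg Prod.fst hij)
  · exact (hlt j hj i hi hl).ne' (congrArg Prod.fst hij)

/-- For a histogram region with `k` tooth columns, the optimal number of
hidden guards equals the optimal number of guards, and both equal `k`: there is a hidden
guard set of size `k`, and every guard set (hidden or not) has at least `k` elements. -/
theorem stmt_8 (N : ℕ) (hN : 1 ≤ N) (x c : ℕ → ℝ)
    (hx : ∀ i, i < N → x i < x (i + 1))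
    (hcpos : ∀ i, 1 ≤ i → i ≤ N → 0 < c i)
    (hcne : ∀ i, 1 ≤ i → i < N → c i ≠ c (i + 1))
    (hc0 : c 0 = 0) (hcN1 : c (N + 1) = 0)
    (P : Set (ℝ × ℝ))
    (hP : P = ⋃ i ∈ Finset.Icc 1 N, Set.Icc (x (i - 1)) (x i) ×ˢ Set.Icc (0 : ℝ) (c i))
    (k : ℕ)
    (hk : k = ((Finset.Icc 1 N).filter (fun i => c (i - 1) < c i ∧ c (i + 1) < c i)).card) :
    (∃ G : Finset (ℝ × ℝ), G.card = k ∧ ↑G ⊆ P ∧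
      (∀ p ∈ P, ∃ g ∈ G, Set.uIcc g.1 p.1 ×ˢ Set.uIcc g.2 p.2 ⊆ P) ∧
      (∀ g ∈ G, ∀ g' ∈ G, g ≠ g' →
        ¬ Set.uIcc g.1 g'.1 ×ˢ Set.uIcc g.2 g'.2 ⊆ P)) ∧
    (∀ G : Set (ℝ × ℝ), G ⊆ P →
      (∀ p ∈ P, ∃ g ∈ G, Set.uIcc g.1 p.1 ×ˢ Set.uIcc g.2 p.2 ⊆ P) →
      (k : ℕ∞) ≤ G.encard) := by
  subst hk hP
  exact ⟨exists_hidden_guards hx hcpos hcne hc0 hcN1,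
    fun _ hG hguard => card_teeth_le_encard_of_guards hx hcpos hG hguard⟩
end

section
/- Let P be a histogram region with breakpoints x_0 < ⋯ < x_N and heights c_1, …, c_N, and let k be the number of tooth columns. Then there exists a guard set of P of cardinality k all of whose elements lie on the base edge [x_0, x_N] × {0}: one can choose one point (t_i, 0) with t_i ∈ [x_{i−1}, x_i] for each tooth column i, and the resulting set guards all of P. (There is an optimal guard set located entirely on the align segment.) -/
theorem exists_column_of_mem_Icc (x : ℕ → ℝ) {l r : ℕ} (hlr : l < r) {u : ℝ}
    (hl : x l ≤ u) (hr : u ≤ x r) :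
    ∃ m, l < m ∧ m ≤ r ∧ x (m - 1) ≤ u ∧ u ≤ x m := by
  induction r, hlr using Nat.le_induction with
  | base => exact ⟨l + 1, by omega, by omega, by simpa using hl, hr⟩
  | succ r hlr ih =>
    rcases le_total u (x r) with h | h
    · obtain ⟨m, h1, h2, h3⟩ := ih h
      exact ⟨m, h1, by omega, h3⟩
    · exact ⟨r + 1, by omega, le_rfl, by simpa using h, hr⟩

/-- From any column one can climb to a tooth without passing a lower column. -/
theorem exists_tooth_above (N : ℕ) (c : ℕ → ℝ)
    (hcpos : ∀ i, 1 ≤ i → i ≤ N → 0 < c i)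
    (hcne : ∀ i, 1 ≤ i → i < N → c i ≠ c (i + 1))
    (hc0 : c 0 = 0) (hcN1 : c (N + 1) = 0) (i : ℕ) (hi1 : 1 ≤ i) (hiN : i ≤ N) :
    ∃ j, 1 ≤ j ∧ j ≤ N ∧ c (j - 1) < c j ∧ c (j + 1) < c j ∧
      ∀ m, min i j ≤ m → m ≤ max i j → c i ≤ c m := by
  classical
  let S := (Finset.Icc 1 N).filter (fun j => ∀ m, min i j ≤ m → m ≤ max i j → c i ≤ c m)
  have hS : ∀ j, j ∈ S ↔ (1 ≤ j ∧ j ≤ N) ∧ ∀ m, min i j ≤ m → m ≤ max i j → c i ≤ c m := by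
    intro j
    simp only [S, Finset.mem_filter, Finset.mem_Icc]
  have hiS : i ∈ S := by
    refine (hS i).2 ⟨⟨hi1, hiN⟩, fun m h1 h2 => ?_⟩
    obtain rfl : m = i := by omega
    exact le_rfl
  obtain ⟨j, hjS, hmax⟩ := S.exists_max_image c ⟨i, hiS⟩
  obtain ⟨⟨hj1, hjN⟩, hj⟩ := (hS j).1 hjS
  have hij : c i ≤ c j := hj j (by omega) (by omega)
  have step : ∀ j', 1 ≤ j' → j' ≤ N → j' ≤ j + 1 → j ≤ j' + 1 → c j ≤ c j' → c j' = c j := by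
    intro j' h1 h2 h3 h4 h5
    refine le_antisymm (hmax j' ((hS j').2 ⟨⟨h1, h2⟩, fun m hm1 hm2 => ?_⟩)) h5
    by_cases hm : m = j'
    · exact hm ▸ hij.trans h5
    · exact hj m (by omega) (by omega)
  refine ⟨j, hj1, hjN, ?_, ?_, hj⟩
  · by_contra! h
    rcases hj1.eq_or_lt with rfl | hlt
    · have := hcpos 1 le_rfl hjN
      simp only [Nat.sub_self] at h
      linarith
    · have h1 := step (j - 1) (by omega) (by omega) (by omega) (by omega) h
      have h2 := hcne (j - 1) (by omega) (by omega)
      rw [Nat.sub_add_cancel hj1] at h2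
      exact h2 h1
  · by_contra! h
    rcases hjN.eq_or_lt with rfl | hlt
    · have := hcpos j hj1 le_rfl
      linarith
    · exact hcne j hj1 hlt (step (j + 1) (by omega) (by omega) (by omega) (by omega) h).symm


/-- A histogram region with `k` tooth columns has a guard set of cardinality
`k` lying entirely on the base edge `[x 0, x N] × {0}`: one point `(t i, 0)` with
`t i ∈ [x (i-1), x i]` for each tooth column `i`, and the resulting set guards `P`. -/
theorem stmt_9 (N : ℕ) (hN : 1 ≤ N) (x c : ℕ → ℝ)
    (hx : ∀ i, i < N → x i < x (i + 1))
    (hcpos : ∀ i, 1 ≤ i → i ≤ N → 0 < c i)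
    (hcne : ∀ i, 1 ≤ i → i < N → c i ≠ c (i + 1))
    (hc0 : c 0 = 0) (hcN1 : c (N + 1) = 0)
    (P : Set (ℝ × ℝ))
    (hP : P = ⋃ i ∈ Finset.Icc 1 N, Set.Icc (x (i - 1)) (x i) ×ˢ Set.Icc (0 : ℝ) (c i))
    (k : ℕ)
    (hk : k = ((Finset.Icc 1 N).filter (fun i => c (i - 1) < c i ∧ c (i + 1) < c i)).card) :
    ∃ t : ℕ → ℝ,
      (∀ i ∈ (Finset.Icc 1 N).filter (fun i => c (i - 1) < c i ∧ c (i + 1) < c i),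
        t i ∈ Set.Icc (x (i - 1)) (x i)) ∧
      ∀ G : Finset (ℝ × ℝ),
        G = ((Finset.Icc 1 N).filter (fun i => c (i - 1) < c i ∧ c (i + 1) < c i)).image
              (fun i => ((t i, 0) : ℝ × ℝ)) →
        G.card = k ∧ ↑G ⊆ P ∧ ↑G ⊆ Set.Icc (x 0) (x N) ×ˢ ({(0 : ℝ)} : Set ℝ) ∧
          ∀ p ∈ P, ∃ g ∈ G, Set.uIcc g.1 p.1 ×ˢ Set.uIcc g.2 p.2 ⊆ P := by
  have hmono : ∀ i j, i ≤ j → j ≤ N → x i ≤ x j := by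
    intro i j hij
    induction j, hij using Nat.le_induction with
    | base => exact fun _ => le_rfl
    | succ j _ ih => exact fun h => (ih (by omega)).trans (hx j (by omega)).le
  have hcol : ∀ i, 1 ≤ i → i ≤ N → x (i - 1) < x i := by
    intro i h1 h2
    have := hx (i - 1) (by omega)
    rwa [Nat.sub_add_cancel h1] at this
  have memP : ∀ p : ℝ × ℝ, p ∈ P ↔
      ∃ i, (1 ≤ i ∧ i ≤ N) ∧ (x (i - 1) ≤ p.1 ∧ p.1 ≤ x i) ∧ 0 ≤ p.2 ∧ p.2 ≤ c i := by
    intro p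
    simp only [hP, Set.mem_iUnion, Set.mem_prod, Set.mem_Icc, Finset.mem_Icc, exists_prop]
  let t : ℕ → ℝ := fun i => (x (i - 1) + x i) / 2
  have ht : ∀ i, 1 ≤ i → i ≤ N → x (i - 1) < t i ∧ t i < x i := by
    intro i h1 h2
    have := hcol i h1 h2
    constructor <;> simp only [t] <;> linarith
  have htlt : ∀ i j, 1 ≤ i → i < j → j ≤ N → t i < t j := fun i j h1 h2 h3 =>
    ((ht i h1 (by omega)).2.trans_le (hmono i (j - 1) (by omega) (by omega))).trans
      (ht j (by omega) h3).1
  refine ⟨t, ?_, ?_⟩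
  · intro i hi
    simp only [Finset.mem_filter, Finset.mem_Icc] at hi
    exact ⟨(ht i hi.1.1 hi.1.2).1.le, (ht i hi.1.1 hi.1.2).2.le⟩
  rintro G rfl
  refine ⟨?_, ?_, ?_, ?_⟩
  · rw [hk]
    refine Finset.card_image_of_injOn fun i hi j hj hij => ?_
    simp only [Finset.coe_filter, Set.mem_ofPred_eq, Finset.mem_Icc] at hi hj
    have hij' : t i = t j := congrArg Prod.fst hij
    rcases lt_trichotomy i j with h | h | h
    · exact absurd hij' (htlt i j hi.1.1 h hj.1.2).ne
    · exact h
    · exact absurd hij' (htlt j i hj.1.1 h hi.1.2).ne'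
  · intro p hp
    simp only [Finset.coe_image, Set.mem_image, Finset.coe_filter, Set.mem_ofPred_eq,
      Finset.mem_Icc] at hp
    obtain ⟨i, ⟨⟨h1, h2⟩, -⟩, rfl⟩ := hp
    exact (memP _).2 ⟨i, ⟨h1, h2⟩, ⟨(ht i h1 h2).1.le, (ht i h1 h2).2.le⟩, le_rfl,
      (hcpos i h1 h2).le⟩
  · intro p hp
    simp only [Finset.coe_image, Set.mem_image, Finset.coe_filter, Set.mem_ofPred_eq,
      Finset.mem_Icc] at hp
    obtain ⟨i, ⟨⟨h1, h2⟩, -⟩, rfl⟩ := hp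
    exact ⟨⟨(hmono 0 (i - 1) (by omega) (by omega)).trans (ht i h1 h2).1.le,
      (ht i h1 h2).2.le.trans (hmono i N h2 le_rfl)⟩, rfl⟩
  · intro p hp
    obtain ⟨i, ⟨hi1, hiN⟩, ⟨hpl, hpr⟩, hp0, hpc⟩ := (memP p).1 hp
    obtain ⟨j, hj1, hjN, hjl, hjr, hj⟩ :=
      exists_tooth_above N c hcpos hcne hc0 hcN1 i hi1 hiN
    refine ⟨(t j, 0), Finset.mem_image.2 ⟨j, ?_, rfl⟩, ?_⟩
    · simp only [Finset.mem_filter, Finset.mem_Icc]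
      exact ⟨⟨hj1, hjN⟩, hjl, hjr⟩
    rintro q ⟨hq1, hq2⟩
    simp only [Set.uIcc_of_le hp0, Set.mem_Icc] at hq2
    obtain ⟨hql, hqr⟩ := hq1
    have hl : x (min i j - 1) ≤ q.1 := (le_inf
      ((hmono _ (j - 1) (by omega) (by omega)).trans (ht j hj1 hjN).1.le)
      ((hmono _ (i - 1) (by omega) (by omega)).trans hpl)).trans hql
    have hr : q.1 ≤ x (max i j) := hqr.trans (sup_le
      ((ht j hj1 hjN).2.le.trans (hmono j _ (by omega) (by omega)))
      (hpr.trans (hmono i _ (by omega) (by omega))))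
    obtain ⟨m, hm1, hm2, hm⟩ := exists_column_of_mem_Icc x (by omega) hl hr
    exact (memP q).2 ⟨m, ⟨by omega, by omega⟩, hm, hq2.1,
      hq2.2.trans (hpc.trans (hj m (by omega) hm2))⟩
end

section
/- Let P be a histogram region with breakpoints x_0 < ⋯ < x_N and heights c_1, …, c_N, and let i < j be two distinct tooth columns. Then j ≥ i + 2, and for any points p, q ∈ P with p.1 ∈ [x_{i−1}, x_i], q.1 ∈ [x_{j−1}, x_j], if max(p.2, q.2) > min_{i < t < j} c_t then p and q are not r-visible in P. In particular, any two guards placed in distinct tooth columns strictly above the minimal intermediate column height (the dent between their pyramids) are mutually invisible. -/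
/-- For two distinct tooth columns `i < j` of a histogram region we have
`j ≥ i + 2`, and any points `p, q ∈ P` lying (in x) over the respective tooth columns with
`max p.2 q.2` strictly above the minimal intermediate column height are not r-visible. -/
theorem stmt_10 (N : ℕ) (hN : 1 ≤ N) (x c : ℕ → ℝ)
    (hx : ∀ i, i < N → x i < x (i + 1))
    (hcpos : ∀ i, 1 ≤ i → i ≤ N → 0 < c i)
    (hcne : ∀ i, 1 ≤ i → i < N → c i ≠ c (i + 1))
    (hc0 : c 0 = 0) (hcN1 : c (N + 1) = 0)
    (P : Set (ℝ × ℝ))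
    (hP : P = ⋃ i ∈ Finset.Icc 1 N, Set.Icc (x (i - 1)) (x i) ×ˢ Set.Icc (0 : ℝ) (c i))
    (i j : ℕ) (hi1 : 1 ≤ i) (hiN : i ≤ N) (hj1 : 1 ≤ j) (hjN : j ≤ N) (hij : i < j)
    (hti : c (i - 1) < c i ∧ c (i + 1) < c i)
    (htj : c (j - 1) < c j ∧ c (j + 1) < c j) :
    i + 2 ≤ j ∧
    ∀ p ∈ P, ∀ q ∈ P, p.1 ∈ Set.Icc (x (i - 1)) (x i) → q.1 ∈ Set.Icc (x (j - 1)) (x j) →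
      sInf (c '' {t : ℕ | i < t ∧ t < j}) < max p.2 q.2 →
      ¬ Set.uIcc p.1 q.1 ×ˢ Set.uIcc p.2 q.2 ⊆ P := by
  have hmono : ∀ a b, a ≤ b → b ≤ N → x a ≤ x b := by
    intro a b hab
    induction b, hab using Nat.le_induction with
    | base => exact fun _ => le_rfl
    | succ b _ ih => exact fun hb => (ih (by omega)).trans (hx b (by omega)).le
  have hgap : i + 2 ≤ j := by
    by_contra h
    obtain rfl : j = i + 1 := by omega
    exact lt_asymm hti.2 htj.1
  refine ⟨hgap, fun p _ q _ hp hq hlt hsub => ?_⟩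
  obtain ⟨_, ⟨t, ⟨hit, htj'⟩, rfl⟩, hct⟩ :=
    exists_lt_of_csInf_lt (Set.Nonempty.image c (s := {t : ℕ | i < t ∧ t < j}) ⟨i + 1, by constructor <;> omega⟩) hlt
  have hxt : x (t - 1) < x t := by
    simpa [Nat.sub_add_cancel (show 1 ≤ t by omega)] using hx (t - 1) (by omega)
  obtain ⟨m, hm1, hm2⟩ := exists_between hxt
  have hpm : p.1 ≤ m := (hp.2.trans (hmono i (t - 1) (by omega) (by omega))).trans hm1.le
  have hmq : m ≤ q.1 := hm2.le.trans ((hmono t (j - 1) (by omega) (by omega)).trans hq.1)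
  have hmem : (m, max p.2 q.2) ∈ P :=
    hsub ⟨Set.mem_uIcc_of_le hpm hmq, inf_le_sup, le_rfl⟩
  simp only [hP, Set.mem_iUnion, Set.mem_prod, Set.mem_Icc, Finset.mem_Icc] at hmem
  obtain ⟨k, ⟨_, hkN⟩, ⟨hk1, hk2⟩, _, hk3⟩ := hmem
  obtain h | rfl | h := lt_trichotomy k t
  · linarith [hmono k (t - 1) (by omega) (by omega)]
  · linarith
  · linarith [hmono t (k - 1) (by omega) (by omega)]
end

section
/- Let P be a balanced x-monotone orthogonal region and let T be any collection of teeth (upper or lower) whose column intervals [x_{i−1}, x_i] are pairwise disjoint. Then every set G ⊆ P that guards P satisfies |G| ≥ |T|. More precisely, for each upper tooth i any guard that r-sees some point of the edge [x_{i−1}, x_i] × {u_i} must have first coordinate in [x_{i−1}, x_i], and symmetrically for each lower tooth i with the edge [x_{i−1}, x_i] × {l_i}. -/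
/-- Column `i` is an upper tooth of the balanced x-monotone region with upper heights `u`. -/
def UpperTooth (N : ℕ) (u : ℕ → ℝ) (i : ℕ) : Prop :=
  1 ≤ i ∧ i ≤ N ∧ (i = 1 ∨ u (i - 1) < u i) ∧ (i = N ∨ u (i + 1) < u i)

/-- Column `i` is a lower tooth of the balanced x-monotone region with lower heights `l`. -/
def LowerTooth (N : ℕ) (l : ℕ → ℝ) (i : ℕ) : Prop :=
  1 ≤ i ∧ i ≤ N ∧ (i = 1 ∨ l i < l (i - 1)) ∧ (i = N ∨ l i < l (i + 1))

/-- A tooth is a pair (column, side): side `true` is an upper tooth, `false` a lower tooth. -/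
def ToothAt (N : ℕ) (l u : ℕ → ℝ) (t : ℕ × Bool) : Prop :=
  if t.2 then UpperTooth N u t.1 else LowerTooth N l t.1

/-- A point of the region strictly inside the interval of column `j` has height in the
interval of column `j`. -/
theorem height_mem_of_mem_region {N : ℕ} {x l u : ℕ → ℝ}
    (hx : ∀ i, i < N → x i < x (i + 1)) {j : ℕ} (hj : j ≤ N) {a b : ℝ}
    (ha : a ∈ Set.Ioo (x (j - 1)) (x j))
    (h : (a, b) ∈ ⋃ i ∈ Finset.Icc 1 N, Set.Icc (x (i - 1)) (x i) ×ˢ Set.Icc (l i) (u i)) :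
    b ∈ Set.Icc (l j) (u j) := by
  simp only [Set.mem_iUnion, Finset.mem_Icc, Set.mem_prod, exists_prop] at h
  obtain ⟨k, ⟨hk1, hkN⟩, hak, hbk⟩ := h
  rcases lt_trichotomy k j with hkj | rfl | hjk
  · have := breakpoints_le hx (show k ≤ j - 1 by omega) (by omega)
    linarith [hak.2, ha.1]
  · exact hbk
  · have := breakpoints_le hx (show j ≤ k - 1 by omega) (by omega)
    linarith [hak.1, ha.2]

/-- A horizontal segment inside the region that meets column `i` at a height which neither
neighbouring column attains stays within the interval of column `i`. -/
theorem mem_Icc_of_segment_subset_region {N : ℕ} {x l u : ℕ → ℝ}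
    (hx : ∀ i, i < N → x i < x (i + 1)) {i : ℕ} (hi : 1 ≤ i) (hiN : i ≤ N) {a q b : ℝ}
    (ha : a ∈ Set.Icc (x 0) (x N)) (hq : q ∈ Set.Icc (x (i - 1)) (x i))
    (hleft : i = 1 ∨ b ∉ Set.Icc (l (i - 1)) (u (i - 1)))
    (hright : i = N ∨ b ∉ Set.Icc (l (i + 1)) (u (i + 1)))
    (h : ∀ c ∈ Set.uIcc a q,
      (c, b) ∈ ⋃ i ∈ Finset.Icc 1 N, Set.Icc (x (i - 1)) (x i) ×ˢ Set.Icc (l i) (u i)) :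
    a ∈ Set.Icc (x (i - 1)) (x i) := by
  constructor
  · by_contra! hlt
    rcases eq_or_lt_of_le hi with rfl | hi'
    · exact absurd ha.1 (not_le.mpr hlt)
    have hb := hleft.resolve_left hi'.ne'
    have hstep : x (i - 1 - 1) < x (i - 1) := by
      have := hx (i - 1 - 1) (by omega)
      rwa [show i - 1 - 1 + 1 = i - 1 by omega] at this
    obtain ⟨c, hc, hc'⟩ := exists_between (max_lt hlt hstep)
    obtain ⟨hac, hxc⟩ := max_lt_iff.mp hc
    exact hb (height_mem_of_mem_region hx (by omega) ⟨hxc, hc'⟩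
      (h c (Set.mem_uIcc_of_le hac.le (hc'.le.trans hq.1))))
  · by_contra! hlt
    rcases eq_or_lt_of_le hiN with rfl | hiN'
    · exact absurd ha.2 (not_le.mpr hlt)
    have hb := hright.resolve_left hiN'.ne
    obtain ⟨c, hc', hc⟩ := exists_between (lt_min hlt (hx i hiN'))
    obtain ⟨hca, hcx⟩ := lt_min_iff.mp hc
    exact hb (height_mem_of_mem_region hx (by omega) ⟨hc', hcx⟩
      (h c (Set.mem_uIcc_of_ge (hq.2.trans hc'.le) hca.le)))

/-- If every member of a finite family of pairwise disjoint sets contains the first coordinate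
of a point of `G`, then `G` has at least as many points as the family has members. -/
theorem card_le_encard_of_disjoint {ι α β : Type*} {T : Finset ι} {I : ι → Set α}
    (hdisj : ∀ t ∈ T, ∀ t' ∈ T, t ≠ t' → Disjoint (I t) (I t')) {G : Set (α × β)}
    (h : ∀ t ∈ T, ∃ g ∈ G, g.1 ∈ I t) : (T.card : ℕ∞) ≤ G.encard := by
  obtain rfl | ⟨t₀, ht₀⟩ := T.eq_empty_or_nonempty
  · simp
  have : Nonempty (α × β) := ⟨(h t₀ ht₀).choose⟩
  choose! f hfG hfI using h
  rw [← Set.encard_coe_eq_coe_finsetCard]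
  refine Set.encard_le_encard_of_injOn (f := f) hfG fun t ht t' ht' hff => ?_
  by_contra hne
  exact Set.disjoint_left.mp (hdisj t ht t' ht' hne) (hfI t ht) (hff ▸ hfI t' ht')

/-- In a balanced x-monotone orthogonal region, for any collection `T` of
teeth with pairwise disjoint column intervals, every guard set `G ⊆ P` has `|G| ≥ |T|`;
moreover a guard r-seeing a point of an upper (resp. lower) tooth edge of column `i` has
first coordinate in `[x (i-1), x i]`. -/
theorem stmt_12 (N : ℕ) (hN : 1 ≤ N) (x l u : ℕ → ℝ)
    (hx : ∀ i, i < N → x i < x (i + 1))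
    (hlu : ∀ i, 1 ≤ i → i ≤ N → l i < u i)
    (hune : ∀ i, 1 ≤ i → i < N → u i ≠ u (i + 1))
    (hlne : ∀ i, 1 ≤ i → i < N → l i ≠ l (i + 1))
    (hbal : ∀ i, 1 ≤ i → i ≤ N → ∀ j, 1 ≤ j → j ≤ N → l i ≤ u j)
    (P : Set (ℝ × ℝ))
    (hP : P = ⋃ i ∈ Finset.Icc 1 N, Set.Icc (x (i - 1)) (x i) ×ˢ Set.Icc (l i) (u i))
    (T : Finset (ℕ × Bool))
    (hT : ∀ t ∈ T, ToothAt N l u t)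
    (hdisj : ∀ t ∈ T, ∀ t' ∈ T, t ≠ t' →
      Disjoint (Set.Icc (x (t.1 - 1)) (x t.1)) (Set.Icc (x (t'.1 - 1)) (x t'.1))) :
    (∀ G ⊆ P, (∀ p ∈ P, ∃ g ∈ G, Set.uIcc g.1 p.1 ×ˢ Set.uIcc g.2 p.2 ⊆ P) →
        (T.card : ℕ∞) ≤ G.encard) ∧
    (∀ i : ℕ, UpperTooth N u i →
      ∀ g ∈ P, (∃ q ∈ Set.Icc (x (i - 1)) (x i) ×ˢ ({u i} : Set ℝ),
          Set.uIcc g.1 q.1 ×ˢ Set.uIcc g.2 q.2 ⊆ P) →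
        g.1 ∈ Set.Icc (x (i - 1)) (x i)) ∧
    (∀ i : ℕ, LowerTooth N l i →
      ∀ g ∈ P, (∃ q ∈ Set.Icc (x (i - 1)) (x i) ×ˢ ({l i} : Set ℝ),
          Set.uIcc g.1 q.1 ×ˢ Set.uIcc g.2 q.2 ⊆ P) →
        g.1 ∈ Set.Icc (x (i - 1)) (x i)) := by
  have hrange : ∀ g ∈ P, g.1 ∈ Set.Icc (x 0) (x N) := by
    rintro ⟨a, b⟩ hg
    simp only [hP, Set.mem_iUnion, Finset.mem_Icc, Set.mem_prod, exists_prop] at hg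
    obtain ⟨k, ⟨hk1, hkN⟩, hak, -⟩ := hg
    exact ⟨(breakpoints_le hx (Nat.zero_le _) (by omega)).trans hak.1,
      hak.2.trans (breakpoints_le hx hkN le_rfl)⟩
  have hupper : ∀ i : ℕ, UpperTooth N u i →
      ∀ g ∈ P, (∃ q ∈ Set.Icc (x (i - 1)) (x i) ×ˢ ({u i} : Set ℝ),
          Set.uIcc g.1 q.1 ×ˢ Set.uIcc g.2 q.2 ⊆ P) →
        g.1 ∈ Set.Icc (x (i - 1)) (x i) := by
    rintro i ⟨hi, hiN, hl, hr⟩ g hg ⟨⟨q, b⟩, ⟨hq, rfl⟩, hsub⟩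
    rw [hP] at hsub
    exact mem_Icc_of_segment_subset_region hx hi hiN (hrange g hg) hq
      (hl.imp_right fun h hb => not_le.mpr h hb.2) (hr.imp_right fun h hb => not_le.mpr h hb.2)
      fun c hc => hsub ⟨hc, Set.right_mem_uIcc⟩
  have hlower : ∀ i : ℕ, LowerTooth N l i →
      ∀ g ∈ P, (∃ q ∈ Set.Icc (x (i - 1)) (x i) ×ˢ ({l i} : Set ℝ),
          Set.uIcc g.1 q.1 ×ˢ Set.uIcc g.2 q.2 ⊆ P) →
        g.1 ∈ Set.Icc (x (i - 1)) (x i) := by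
    rintro i ⟨hi, hiN, hl, hr⟩ g hg ⟨⟨q, b⟩, ⟨hq, rfl⟩, hsub⟩
    rw [hP] at hsub
    exact mem_Icc_of_segment_subset_region hx hi hiN (hrange g hg) hq
      (hl.imp_right fun h hb => not_le.mpr h hb.1) (hr.imp_right fun h hb => not_le.mpr h hb.1)
      fun c hc => hsub ⟨hc, Set.right_mem_uIcc⟩
  refine ⟨fun G hG hguard => card_le_encard_of_disjoint hdisj fun t ht => ?_, hupper, hlower⟩
  have hcorner : ∀ i, 1 ≤ i → i ≤ N → x (i - 1) ∈ Set.Icc (x (i - 1)) (x i) ∧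
      (x (i - 1), u i) ∈ P ∧ (x (i - 1), l i) ∈ P := by
    intro i hi hiN
    have hmem : x (i - 1) ∈ Set.Icc (x (i - 1)) (x i) :=
      ⟨le_rfl, breakpoints_le hx (Nat.sub_le i 1) hiN⟩
    have hheight := (hlu i hi hiN).le
    rw [hP]
    exact ⟨hmem,
      Set.mem_biUnion (Finset.mem_Icc.mpr ⟨hi, hiN⟩) ⟨hmem, hheight, le_rfl⟩,
      Set.mem_biUnion (Finset.mem_Icc.mpr ⟨hi, hiN⟩) ⟨hmem, le_rfl, hheight⟩⟩
  obtain ⟨i, side⟩ := t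
  cases side with
  | true =>
    have htooth : UpperTooth N u i := hT _ ht
    obtain ⟨hmem, hu, -⟩ := hcorner i htooth.1 htooth.2.1
    obtain ⟨g, hg, hsub⟩ := hguard _ hu
    exact ⟨g, hg, hupper i htooth g (hG hg) ⟨_, ⟨hmem, Set.mem_singleton _⟩, hsub⟩⟩
  | false =>
    have htooth : LowerTooth N l i := by simpa [ToothAt] using hT _ ht
    obtain ⟨hmem, -, hl⟩ := hcorner i htooth.1 htooth.2.1
    obtain ⟨g, hg, hsub⟩ := hguard _ hl
    exact ⟨g, hg, hlower i htooth g (hG hg) ⟨_, ⟨hmem, Set.mem_singleton _⟩, hsub⟩⟩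
end

section
/- Let P be a balanced x-monotone orthogonal region with align level y_0 (max_i l_i ≤ y_0 ≤ min_i u_i), and let κ be the maximum cardinality of a collection of teeth whose column intervals [x_{i−1}, x_i] are pairwise disjoint. Then there exists a guard set G of P with |G| = κ all of whose elements lie on the align segment [x_0, x_N] × {y_0}; consequently the minimum cardinality of a guard set of P equals κ, and this minimum is attained by a guard set contained in the align segment. -/
/-- A finite family of closed intervals has a pairwise disjoint subfamily whose right endpoints
stab every interval of the family. -/
theorem exists_disjoint_subfamily_stabbing {ι : Type*} (f g : ι → ℝ) (S : Finset ι)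
    (hfg : ∀ s ∈ S, f s ≤ g s) :
    ∃ T ⊆ S, (∀ t ∈ T, ∀ t' ∈ T, t ≠ t' → Disjoint (Set.Icc (f t) (g t)) (Set.Icc (f t') (g t'))) ∧
      ∀ s ∈ S, ∃ t ∈ T, g t ∈ Set.Icc (f s) (g s) := by
  classical
  induction S using Finset.strongInduction with
  | H S ih =>
    rcases S.eq_empty_or_nonempty with rfl | hne
    · exact ⟨∅, by simp⟩
    obtain ⟨m, hm, hmin⟩ := S.exists_min_image g hne
    have hss : S.filter (fun s => g m < f s) ⊂ S := by
      refine Finset.filter_ssubset.2 ⟨m, hm, ?_⟩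
      exact not_lt.2 (hfg m hm)
    obtain ⟨T, hTS, hdisj, hstab⟩ := ih _ hss fun s hs => hfg s (Finset.mem_filter.1 hs).1
    have hsep : ∀ t ∈ T, Disjoint (Set.Icc (f m) (g m)) (Set.Icc (f t) (g t)) := by
      intro t ht
      have := (Finset.mem_filter.1 (hTS ht)).2
      refine Set.disjoint_left.2 fun a ha ha' => ?_
      linarith [ha.2, ha'.1]
    refine ⟨insert m T, ?_, ?_, ?_⟩
    · exact Finset.insert_subset hm (hTS.trans (Finset.filter_subset _ _))
    · intro t ht t' ht' hne
      rcases Finset.mem_insert.1 ht with h | h <;>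
        rcases Finset.mem_insert.1 ht' with h' | h'
      · exact absurd (h.trans h'.symm) hne
      · exact h ▸ hsep _ h'
      · exact h' ▸ (hsep _ h).symm
      · exact hdisj t h t' h' hne
    · intro s hs
      by_cases h : g m < f s
      · obtain ⟨t, ht, hts⟩ := hstab s (Finset.mem_filter.2 ⟨hs, h⟩)
        exact ⟨t, Finset.mem_insert_of_mem ht, hts⟩
      · exact ⟨m, Finset.mem_insert_self _ _, not_lt.1 h, hmin s hs⟩

theorem exists_upperTooth_right (N : ℕ) (u : ℕ → ℝ)
    (hune : ∀ i, 1 ≤ i → i < N → u i ≠ u (i + 1)) (i : ℕ) (h1 : 1 ≤ i) (hN : i ≤ N)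
    (hleft : i = 1 ∨ u (i - 1) < u i) :
    ∃ j, UpperTooth N u j ∧ ∀ k ∈ Set.uIcc i j, u i ≤ u k := by
  suffices ∃ j, UpperTooth N u j ∧ i ≤ j ∧ ∀ k ∈ Set.Icc i j, u i ≤ u k by
    obtain ⟨j, hj, hij, hk⟩ := this
    exact ⟨j, hj, by rwa [Set.uIcc_of_le hij]⟩
  induction hN using Nat.decreasingInduction with
  | self => exact ⟨N, ⟨h1, le_rfl, hleft, Or.inl rfl⟩, le_rfl, by simp⟩
  | of_succ i hi ih =>
    rcases lt_or_gt_of_ne (hune i h1 hi) with h | h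
    · obtain ⟨j, hj, hij, hk⟩ := ih (by omega) (Or.inr h)
      refine ⟨j, hj, by omega, fun k hk' => ?_⟩
      rcases hk'.1.eq_or_lt with rfl | hlt
      · exact le_rfl
      · exact h.le.trans (hk k ⟨hlt, hk'.2⟩)
    · exact ⟨i, ⟨h1, hi.le, hleft, Or.inr h⟩, le_rfl, by simp⟩

theorem exists_upperTooth_left (N : ℕ) (u : ℕ → ℝ)
    (hune : ∀ i, 1 ≤ i → i < N → u i ≠ u (i + 1)) (i : ℕ) (h1 : 1 ≤ i) (hN : i ≤ N)
    (hright : i = N ∨ u (i + 1) < u i) :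
    ∃ j, UpperTooth N u j ∧ ∀ k ∈ Set.uIcc i j, u i ≤ u k := by
  suffices ∃ j, UpperTooth N u j ∧ j ≤ i ∧ ∀ k ∈ Set.Icc j i, u i ≤ u k by
    obtain ⟨j, hj, hij, hk⟩ := this
    exact ⟨j, hj, by rwa [Set.uIcc_of_ge hij]⟩
  induction i, h1 using Nat.le_induction with
  | base => exact ⟨1, ⟨le_rfl, hN, Or.inl rfl, hright⟩, le_rfl, by simp⟩
  | succ i h1 ih =>
    rcases lt_or_gt_of_ne (hune i h1 (by omega)) with h | h
    · exact ⟨i + 1, ⟨by omega, hN, Or.inr h, hright⟩, le_rfl, by simp⟩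
    · obtain ⟨j, hj, hij, hk⟩ := ih (by omega) (Or.inr h)
      refine ⟨j, hj, by omega, fun k hk' => ?_⟩
      rcases hk'.2.eq_or_lt with rfl | hlt
      · exact le_rfl
      · exact h.le.trans (hk k ⟨hk'.1, by omega⟩)

/-- From every column one can walk to an upper tooth without going below the starting height. -/
theorem exists_upperTooth (N : ℕ) (u : ℕ → ℝ)
    (hune : ∀ i, 1 ≤ i → i < N → u i ≠ u (i + 1)) (i : ℕ) (h1 : 1 ≤ i) (hN : i ≤ N) :
    ∃ j, UpperTooth N u j ∧ ∀ k ∈ Set.uIcc i j, u i ≤ u k := by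
  by_cases hright : i = N ∨ u (i + 1) < u i
  · exact exists_upperTooth_left N u hune i h1 hN hright
  · push Not at hright
    have hlt : i < N := lt_of_le_of_ne hN hright.1
    have hu : u i < u (i + 1) := lt_of_le_of_ne hright.2 (hune i h1 hlt)
    obtain ⟨j, hj, hk⟩ := exists_upperTooth_right N u hune (i + 1) (by omega) hlt (Or.inr hu)
    refine ⟨j, hj, fun k hk' => ?_⟩
    rcases eq_or_ne k i with rfl | hne
    · exact le_rfl
    · by_cases hk2 : k ∈ Set.uIcc (i + 1) j
      · exact hu.le.trans (hk k hk2)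
      · have hi := hk i
        simp only [Set.mem_uIcc] at *
        have := hi (by omega)
        linarith

theorem lowerTooth_iff_upperTooth_neg (N : ℕ) (l : ℕ → ℝ) (i : ℕ) :
    LowerTooth N l i ↔ UpperTooth N (fun k => -l k) i := by
  simp [LowerTooth, UpperTooth]

theorem exists_lowerTooth (N : ℕ) (l : ℕ → ℝ)
    (hlne : ∀ i, 1 ≤ i → i < N → l i ≠ l (i + 1)) (i : ℕ) (h1 : 1 ≤ i) (hN : i ≤ N) :
    ∃ j, LowerTooth N l j ∧ ∀ k ∈ Set.uIcc i j, l k ≤ l i := by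
  obtain ⟨j, hj, hk⟩ := exists_upperTooth N (fun k => -l k)
    (fun i h h' e => hlne i h h' (neg_injective e)) i h1 hN
  exact ⟨j, (lowerTooth_iff_upperTooth_neg N l j).2 hj, fun k hk' => neg_le_neg_iff.1 (hk k hk')⟩

/-- Breakpoints increasing step by step up to `N` are strictly increasing up to `N`. -/
theorem breakpoints_strictMonoOn (N : ℕ) (x : ℕ → ℝ) (hx : ∀ i, i < N → x i < x (i + 1)) :
    StrictMonoOn x (Set.Iic N) := by
  intro i _ j hj hij
  induction j, Nat.succ_le_of_lt hij using Nat.le_induction with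
  | base => exact hx i hj
  | succ j h ih =>
    have hj' : j + 1 ≤ N := hj
    exact (ih (show j ≤ N by omega) (by omega)).trans (hx j (by omega))

theorem exists_column_mem (x : ℕ → ℝ) (i j : ℕ) (hij : i ≤ j) (c : ℝ)
    (hc : c ∈ Set.Icc (x (i - 1)) (x j)) :
    ∃ k ∈ Set.Icc i j, c ∈ Set.Icc (x (k - 1)) (x k) := by
  induction j, hij using Nat.le_induction with
  | base => exact ⟨i, by simp, hc⟩
  | succ j h ih =>
    rcases le_total c (x j) with h' | h'
    · obtain ⟨k, hk, hck⟩ := ih ⟨hc.1, h'⟩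
      exact ⟨k, ⟨hk.1, hk.2.trans j.le_succ⟩, hck⟩
    · exact ⟨j + 1, ⟨by omega, le_rfl⟩, by simpa using h', hc.2⟩

/-- Points of two columns see each other if all columns between reach the heights of both. -/
theorem uIcc_prod_uIcc_subset_columns (N : ℕ) (x l u : ℕ → ℝ)
    (hx : ∀ i, i < N → x i < x (i + 1)) (i j : ℕ) (hi1 : 1 ≤ i) (hi : i ≤ N) (hj1 : 1 ≤ j)
    (hj : j ≤ N) (a b c d : ℝ) (ha : a ∈ Set.Icc (x (i - 1)) (x i))
    (hc : c ∈ Set.Icc (x (j - 1)) (x j))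
    (hk : ∀ k ∈ Set.uIcc i j, Set.uIcc d b ⊆ Set.Icc (l k) (u k)) :
    Set.uIcc c a ×ˢ Set.uIcc d b ⊆
      ⋃ i ∈ Finset.Icc 1 N, Set.Icc (x (i - 1)) (x i) ×ˢ Set.Icc (l i) (u i) := by
  rintro ⟨e, f⟩ ⟨he, hf⟩
  have hmono := (breakpoints_strictMonoOn N x hx).monotoneOn
  have key : ∃ k ∈ Set.uIcc i j, e ∈ Set.Icc (x (k - 1)) (x k) := by
    have hle : ∀ m n, m ≤ n → n ≤ N → x m ≤ x n := fun m n hmn hn =>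
      hmono (show m ≤ N by omega) hn hmn
    simp only [Set.mem_uIcc] at he
    rcases le_total i j with h | h
    · rw [Set.uIcc_of_le h]
      refine exists_column_mem x i j h e ?_
      have h1 := hle (i - 1) (j - 1) (by omega) (by omega)
      have h2 := hle i j h hj
      constructor <;> rcases he with he | he <;> linarith [ha.1, ha.2, hc.1, hc.2]
    · rw [Set.uIcc_of_ge h]
      refine exists_column_mem x j i h e ?_
      have h1 := hle (j - 1) (i - 1) (by omega) (by omega)
      have h2 := hle j i h hi
      constructor <;> rcases he with he | he <;> linarith [ha.1, ha.2, hc.1, hc.2]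
  obtain ⟨k, hkm, hek⟩ := key
  have hkN : k ∈ Finset.Icc 1 N := by
    simp only [Set.mem_uIcc] at hkm
    simp only [Finset.mem_Icc]
    omega
  exact Set.mem_biUnion hkN ⟨hek, hk k hkm hf⟩

/-- A point seeing, along height `h`, the interior of a column whose neighbours both miss `h`
lies above or below that column. -/
theorem mem_column_of_horizontally_visible (N : ℕ) (x l u : ℕ → ℝ)
    (hx : ∀ i, i < N → x i < x (i + 1)) (j : ℕ) (hj1 : 1 ≤ j) (hj : j ≤ N) (h m c : ℝ)
    (hm : m ∈ Set.Icc (x (j - 1)) (x j))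
    (hl : j = 1 ∨ h ∉ Set.Icc (l (j - 1)) (u (j - 1)))
    (hr : j = N ∨ h ∉ Set.Icc (l (j + 1)) (u (j + 1)))
    (hsee : Set.uIcc c m ×ˢ {h} ⊆
      ⋃ i ∈ Finset.Icc 1 N, Set.Icc (x (i - 1)) (x i) ×ˢ Set.Icc (l i) (u i)) :
    c ∈ Set.Icc (x (j - 1)) (x j) := by
  have hsm := breakpoints_strictMonoOn N x hx
  have hle : ∀ m n, m ≤ n → n ≤ N → x m ≤ x n := fun m n hmn hn =>
    hsm.monotoneOn (show m ≤ N by omega) hn hmn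
  have hcol : ∀ e ∈ Set.uIcc c m, ∃ k, 1 ≤ k ∧ k ≤ N ∧ e ∈ Set.Icc (x (k - 1)) (x k) ∧
      h ∈ Set.Icc (l k) (u k) := by
    intro e he
    have hmem := hsee (Set.mk_mem_prod he (Set.mem_singleton h))
    simp only [Set.mem_iUnion, Finset.mem_Icc] at hmem
    obtain ⟨k, hk, hek, hhk⟩ := hmem
    exact ⟨k, hk.1, hk.2, hek, hhk⟩
  by_contra hc
  rw [Set.mem_Icc, not_and_or, not_le, not_le] at hc
  rcases hc with hc | hc
  · have hcm : c ≤ m := hc.le.trans hm.1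
    by_cases hj1' : j = 1
    · obtain ⟨k, -, hkN, hck, -⟩ := hcol c Set.left_mem_uIcc
      have := hle (j - 1) (k - 1) (by omega) (by omega)
      linarith [hck.1]
    have hl := hl.resolve_left hj1'
    have hlt : x (j - 2) < x (j - 1) :=
      hsm (show j - 2 ≤ N by omega) (show j - 1 ≤ N by omega) (by omega)
    obtain ⟨e, he1, he2⟩ := exists_between (max_lt hc hlt)
    have hce := (le_max_left _ _).trans_lt he1
    have hxe := (le_max_right _ _).trans_lt he1
    obtain ⟨k, hk1, hkN, hek, hhk⟩ := hcol e (by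
      rw [Set.uIcc_of_le hcm]
      exact ⟨hce.le, he2.le.trans hm.1⟩)
    have : k = j - 1 := by
      by_contra hne
      rcases lt_or_gt_of_ne hne with hk | hk
      · have := hle k (j - 2) (by omega) (by omega)
        linarith [hek.2]
      · have := hle (j - 1) (k - 1) (by omega) (by omega)
        linarith [hek.1]
    exact hl (this ▸ hhk)
  · have hcm : m ≤ c := hm.2.trans hc.le
    by_cases hjN : j = N
    · obtain ⟨k, -, hkN, hck, -⟩ := hcol c Set.left_mem_uIcc
      have := hle k j (by omega) (by omega)
      linarith [hck.2]
    have hr := hr.resolve_left hjN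
    obtain ⟨e, he1, he2⟩ := exists_between (lt_min hc (hx j (by omega)))
    have hce := he2.trans_le (min_le_left _ _)
    have hxe := he2.trans_le (min_le_right _ _)
    obtain ⟨k, hk1, hkN, hek, hhk⟩ := hcol e (by
      rw [Set.uIcc_of_ge hcm]
      exact ⟨hm.2.trans he1.le, hce.le⟩)
    have : k = j + 1 := by
      by_contra hne
      rcases lt_or_gt_of_ne hne with hk | hk
      · have := hle k j (by omega) (by omega)
        linarith [hek.2]
      · have := hle (j + 1) (k - 1) (by omega) (by omega)
        linarith [hek.1]
    exact hr (this ▸ hhk)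

theorem ToothAt.column_mem {N : ℕ} {l u : ℕ → ℝ} {t : ℕ × Bool} (ht : ToothAt N l u t) :
    1 ≤ t.1 ∧ t.1 ≤ N := by
  unfold ToothAt at ht
  split_ifs at ht
  · exact ⟨ht.1, ht.2.1⟩
  · exact ⟨ht.1, ht.2.1⟩

/-- Every tooth has an edge height that its neighbouring columns miss. -/
theorem ToothAt.exists_height {N : ℕ} {l u : ℕ → ℝ} {t : ℕ × Bool} (ht : ToothAt N l u t)
    (hlu : ∀ i, 1 ≤ i → i ≤ N → l i < u i) :
    ∃ h ∈ Set.Icc (l t.1) (u t.1), (t.1 = 1 ∨ h ∉ Set.Icc (l (t.1 - 1)) (u (t.1 - 1))) ∧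
      (t.1 = N ∨ h ∉ Set.Icc (l (t.1 + 1)) (u (t.1 + 1))) := by
  have hlt := hlu t.1 ht.column_mem.1 ht.column_mem.2
  unfold ToothAt at ht
  split_ifs at ht
  · exact ⟨u t.1, ⟨hlt.le, le_rfl⟩, ht.2.2.1.imp_right fun h h' => h.not_ge h'.2,
      ht.2.2.2.imp_right fun h h' => h.not_ge h'.2⟩
  · exact ⟨l t.1, ⟨le_rfl, hlt.le⟩, ht.2.2.1.imp_right fun h h' => h.not_ge h'.1,
      ht.2.2.2.imp_right fun h h' => h.not_ge h'.1⟩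

/-- Let `κ` be the maximum cardinality of a collection of teeth with pairwise
disjoint column intervals. Then there is a guard set of cardinality `κ` lying on the align
segment `[x 0, x N] × {y₀}`, and every guard set of `P` has at least `κ` elements; so the
minimum number of guards equals `κ` and is attained on the align segment. -/
theorem stmt_13 (N : ℕ) (hN : 1 ≤ N) (x l u : ℕ → ℝ)
    (hx : ∀ i, i < N → x i < x (i + 1))
    (hlu : ∀ i, 1 ≤ i → i ≤ N → l i < u i)
    (hune : ∀ i, 1 ≤ i → i < N → u i ≠ u (i + 1))
    (hlne : ∀ i, 1 ≤ i → i < N → l i ≠ l (i + 1))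
    (hbal : ∀ i, 1 ≤ i → i ≤ N → ∀ j, 1 ≤ j → j ≤ N → l i ≤ u j)
    (P : Set (ℝ × ℝ))
    (hP : P = ⋃ i ∈ Finset.Icc 1 N, Set.Icc (x (i - 1)) (x i) ×ˢ Set.Icc (l i) (u i))
    (y₀ : ℝ) (hy₀ : ∀ i, 1 ≤ i → i ≤ N → l i ≤ y₀ ∧ y₀ ≤ u i)
    (κ : ℕ)
    (hκ : IsGreatest {n : ℕ | ∃ T : Finset (ℕ × Bool),
        (∀ t ∈ T, ToothAt N l u t) ∧
        (∀ t ∈ T, ∀ t' ∈ T, t ≠ t' →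
          Disjoint (Set.Icc (x (t.1 - 1)) (x t.1)) (Set.Icc (x (t'.1 - 1)) (x t'.1))) ∧
        T.card = n} κ) :
    (∃ G : Finset (ℝ × ℝ), G.card = κ ∧ ↑G ⊆ P ∧
      ↑G ⊆ Set.Icc (x 0) (x N) ×ˢ ({y₀} : Set ℝ) ∧
      ∀ p ∈ P, ∃ g ∈ G, Set.uIcc g.1 p.1 ×ˢ Set.uIcc g.2 p.2 ⊆ P) ∧
    (∀ G : Set (ℝ × ℝ), G ⊆ P →
      (∀ p ∈ P, ∃ g ∈ G, Set.uIcc g.1 p.1 ×ˢ Set.uIcc g.2 p.2 ⊆ P) →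
      (κ : ℕ∞) ≤ G.encard) := by
  classical
  subst hP
  obtain ⟨⟨T₀, hT₀, hdisj₀, hcard₀⟩, hmax⟩ := hκ
  have hsm := breakpoints_strictMonoOn N x hx
  have hcolumn : ∀ i, 1 ≤ i → i ≤ N → x (i - 1) < x i := fun i h1 hi =>
    hsm (show i - 1 ≤ N by omega) hi (by omega)
  have lower : ∀ G : Set (ℝ × ℝ),
      (∀ p ∈ ⋃ i ∈ Finset.Icc 1 N, Set.Icc (x (i - 1)) (x i) ×ˢ Set.Icc (l i) (u i), ∃ g ∈ G,
        Set.uIcc g.1 p.1 ×ˢ Set.uIcc g.2 p.2 ⊆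
          ⋃ i ∈ Finset.Icc 1 N, Set.Icc (x (i - 1)) (x i) ×ˢ Set.Icc (l i) (u i)) →
      (κ : ℕ∞) ≤ G.encard := by
    intro G hG
    have hguard : ∀ t ∈ T₀, ∃ g ∈ G, g.1 ∈ Set.Icc (x (t.1 - 1)) (x t.1) := by
      intro t ht
      obtain ⟨h1, hN'⟩ := (hT₀ t ht).column_mem
      obtain ⟨h, hh, hl, hr⟩ := (hT₀ t ht).exists_height hlu
      have hm : x t.1 ∈ Set.Icc (x (t.1 - 1)) (x t.1) := ⟨(hcolumn _ h1 hN').le, le_rfl⟩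
      obtain ⟨g, hg, hsee⟩ := hG (x t.1, h) (Set.mem_biUnion
        (Finset.mem_coe.2 (Finset.mem_Icc.2 ⟨h1, hN'⟩)) ⟨hm, hh⟩)
      refine ⟨g, hg, mem_column_of_horizontally_visible N x l u hx t.1 h1 hN' h _ _ hm hl hr ?_⟩
      refine subset_trans (Set.prod_mono_right ?_) hsee
      exact Set.singleton_subset_iff.2 Set.right_mem_uIcc
    choose! g hgG hg using hguard
    have hinj : Set.InjOn g T₀ := by
      intro t ht t' ht' heq
      by_contra hne
      exact Set.disjoint_left.1 (hdisj₀ t ht t' ht' hne) (hg t ht) (heq ▸ hg t' ht')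
    calc (κ : ℕ∞) = (T₀ : Set (ℕ × Bool)).encard := by
          rw [Set.encard_coe_eq_coe_finsetCard, hcard₀]
      _ = (g '' T₀).encard := hinj.encard_image.symm
      _ ≤ G.encard := Set.encard_le_encard (Set.image_subset_iff.2 hgG)
  refine ⟨?_, fun G _ => lower G⟩
  have hmemS : ∀ t, t ∈ (Finset.Icc 1 N ×ˢ Finset.univ).filter (ToothAt N l u) ↔
      ToothAt N l u t := by
    intro t
    simp only [Finset.mem_filter, Finset.mem_product, Finset.mem_Icc, Finset.mem_univ, and_true,
      and_iff_right_iff_imp]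
    exact ToothAt.column_mem
  obtain ⟨T, hTS, hdisj, hstab⟩ := exists_disjoint_subfamily_stabbing
    (fun t : ℕ × Bool => x (t.1 - 1)) (fun t => x t.1)
    ((Finset.Icc 1 N ×ˢ Finset.univ).filter (ToothAt N l u))
    fun t ht => (hcolumn _ ((hmemS t).1 ht).column_mem.1 ((hmemS t).1 ht).column_mem.2).le
  have hT : ∀ t ∈ T, ToothAt N l u t := fun t ht => (hmemS t).1 (hTS ht)
  let G : Finset (ℝ × ℝ) := T.image fun t => (x t.1, y₀)
  have hsee : ∀ t, ToothAt N l u t → ∀ i, 1 ≤ i → i ≤ N → ∀ a b,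
      a ∈ Set.Icc (x (i - 1)) (x i) →
      (∀ k ∈ Set.uIcc i t.1, Set.uIcc y₀ b ⊆ Set.Icc (l k) (u k)) →
      ∃ g ∈ G, Set.uIcc g.1 a ×ˢ Set.uIcc g.2 b ⊆
        ⋃ i ∈ Finset.Icc 1 N, Set.Icc (x (i - 1)) (x i) ×ˢ Set.Icc (l i) (u i) := by
    intro t ht i h1 hi a b ha hk
    obtain ⟨s, hs, hst⟩ := hstab t ((hmemS t).2 ht)
    exact ⟨_, Finset.mem_image_of_mem _ hs, uIcc_prod_uIcc_subset_columns N x l u hx i t.1 h1 hi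
      ht.column_mem.1 ht.column_mem.2 a b _ y₀ ha hst hk⟩
  have hGguards : ∀ p ∈ ⋃ i ∈ Finset.Icc 1 N, Set.Icc (x (i - 1)) (x i) ×ˢ Set.Icc (l i) (u i),
      ∃ g ∈ G, Set.uIcc g.1 p.1 ×ˢ Set.uIcc g.2 p.2 ⊆
        ⋃ i ∈ Finset.Icc 1 N, Set.Icc (x (i - 1)) (x i) ×ˢ Set.Icc (l i) (u i) := by
    rintro ⟨a, b⟩ hp
    simp only [Set.mem_iUnion, Finset.mem_Icc] at hp
    obtain ⟨i, ⟨h1, hi⟩, ha, hb⟩ := hp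
    have hrange : ∀ j, 1 ≤ j → j ≤ N → ∀ k ∈ Set.uIcc i j, 1 ≤ k ∧ k ≤ N := by
      intro j hj1 hj k hk
      rw [Set.mem_uIcc] at hk
      omega
    rcases le_total y₀ b with h | h
    · obtain ⟨j, hj, hk⟩ := exists_upperTooth N u hune i h1 hi
      refine hsee (j, true) hj i h1 hi a b ha fun k hkm => ?_
      obtain ⟨hk1, hkN⟩ := hrange j hj.1 hj.2.1 k hkm
      rw [Set.uIcc_of_le h]
      exact Set.Icc_subset_Icc (hy₀ k hk1 hkN).1 (hb.2.trans (hk k hkm))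
    · obtain ⟨j, hj, hk⟩ := exists_lowerTooth N l hlne i h1 hi
      refine hsee (j, false) (by simpa [ToothAt] using hj) i h1 hi a b ha fun k hkm => ?_
      obtain ⟨hk1, hkN⟩ := hrange j hj.1 hj.2.1 k hkm
      rw [Set.uIcc_of_ge h]
      exact Set.Icc_subset_Icc ((hk k hkm).trans hb.1) (hy₀ k hk1 hkN).2
  have hGmem : ∀ g ∈ G, ∃ i, 1 ≤ i ∧ i ≤ N ∧ g = (x i, y₀) := by
    intro g hg
    obtain ⟨t, ht, rfl⟩ := Finset.mem_image.1 hg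
    exact ⟨t.1, (hT t ht).column_mem.1, (hT t ht).column_mem.2, rfl⟩
  refine ⟨G, le_antisymm (Finset.card_image_le.trans (hmax ⟨T, hT, hdisj, rfl⟩)) ?_,
    ?_, ?_, hGguards⟩
  · have := lower (G : Set (ℝ × ℝ)) hGguards
    rwa [Set.encard_coe_eq_coe_finsetCard, Nat.cast_le] at this
  · intro g hg
    obtain ⟨i, h1, hi, rfl⟩ := hGmem g hg
    exact Set.mem_biUnion (Finset.mem_coe.2 (Finset.mem_Icc.2 ⟨h1, hi⟩))
      ⟨⟨(hcolumn i h1 hi).le, le_rfl⟩, hy₀ i h1 hi⟩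
  · intro g hg
    obtain ⟨i, h1, hi, rfl⟩ := hGmem g hg
    exact ⟨⟨hsm.monotoneOn (Nat.zero_le N) hi (Nat.zero_le i),
      hsm.monotoneOn hi (show N ≤ N from le_rfl) hi⟩, rfl⟩
end
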